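/- Let k > 1, let n₁ ≥ ⋯ ≥ n_k ≥ 2 be positive integers, let N = ∏_{i=1}^k n_i, and let Ψ : M_N → M_N be a ℂ-linear map with adjoint Ψ* (with respect to the inner product ⟨X,Y⟩ = tr(XY*)). The following are equivalent: (a) W^⊗(Ψ*(T)) = W^⊗(T) for all T ∈ M_N; (b) conv(W^⊗(Ψ*(T))) = conv(W^⊗(T)) for all T ∈ M_N; (c) there is a permutation π of {1,…,k} with n_{π(i)} = n_i for all i, and maps ψ_i on M_{n_i}, each of the form X ↦ U_i X U_i* or X ↦ U_i Xᵀ U_i* for some unitary U_i ∈ M_{n_i}, such that Ψ(⊗_{i=1}^k A_i) = ⊗_{i=1}^k ψ_i(A_{π(i)}) for all A_i ∈ M_{n_i}, i = 1,…,k. -/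

import Mathlib

open Matrix

/-- A pure state: a rank-one Hermitian matrix of trace one. -/
def IsPureState {m : ℕ} (A : Matrix (Fin m) (Fin m) ℂ) : Prop :=
  A.IsHermitian ∧ A.rank = 1 ∧ A.trace = 1

/-- The tensor (Kronecker) product `⊗_{i=1}^k A_i` of matrices `A_i` of sizes `n_i × n_i`:
the `N × N` matrix (`N = ∏ n_i`) with entries
`(⊗ A_i)((x₁,…,x_k),(y₁,…,y_k)) = ∏_i A_i(x_i, y_i)`. -/
def tensorPi {k : ℕ} {n : Fin k → ℕ} (A : ∀ i, Matrix (Fin (n i)) (Fin (n i)) ℂ) :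
    Matrix (∀ i, Fin (n i)) (∀ i, Fin (n i)) ℂ :=
  Matrix.of fun x y => ∏ i, A i (x i) (y i)

/-- The product numerical range `W^⊗(T) = {tr(TZ) : Z ∈ ⊗_{i=1}^k P_{n_i}}` of
`T ∈ M_N ≡ ⊗_{i=1}^k M_{n_i}`. -/
def prodNumRangePi {k : ℕ} {n : Fin k → ℕ}
    (T : Matrix (∀ i, Fin (n i)) (∀ i, Fin (n i)) ℂ) : Set ℂ :=
  {z | ∃ Q : ∀ i, Matrix (Fin (n i)) (Fin (n i)) ℂ,
    (∀ i, IsPureState (Q i)) ∧ z = (T * tensorPi Q).trace}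

namespace PNR

/-- The outer product `x x*`. -/
def kb {m : ℕ} (x : Fin m → ℂ) : Matrix (Fin m) (Fin m) ℂ := vecMulVec x (star x)

theorem kb_apply {m : ℕ} (x : Fin m → ℂ) (a b : Fin m) : kb x a b = x a * star (x b) := rfl

theorem kb_herm {m : ℕ} (x : Fin m → ℂ) : (kb x).IsHermitian := by
  ext a b
  simp [kb_apply, mul_comm]

theorem kb_trace {m : ℕ} (x : Fin m → ℂ) : (kb x).trace = ((∑ a, ‖x a‖ ^ 2 : ℝ) : ℂ) := by
  simp [Matrix.trace, kb_apply, Complex.mul_conj']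

theorem rank_one_minor {m : ℕ} {A : Matrix (Fin m) (Fin m) ℂ} (h : A.rank = 1) (a b c d : Fin m) :
    A a b * A c d = A a d * A c b := by
  unfold Matrix.rank at h
  rw [finrank_eq_one_iff'] at h
  obtain ⟨v, -, hv⟩ := h
  have key : ∀ j, ∃ t : ℂ, ∀ i, A i j = t * v.1 i := by
    intro j
    obtain ⟨t, ht⟩ := hv ⟨A.mulVecLin (Pi.single j 1), LinearMap.mem_range_self _ _⟩
    refine ⟨t, fun i => ?_⟩
    have := congrFun (congrArg Subtype.val ht) i
    simp at this
    exact this.symm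
  obtain ⟨t, ht⟩ := key b
  obtain ⟨s, hs⟩ := key d
  rw [ht, ht, hs, hs]; ring

theorem kb_pure {m : ℕ} {x : Fin m → ℂ} (h : (kb x).trace = 1) : IsPureState (kb x) := by
  refine ⟨kb_herm x, ?_, h⟩
  apply le_antisymm (rank_vecMulVec_le _ _)
  rw [Nat.one_le_iff_ne_zero]
  intro h0
  unfold Matrix.rank at h0
  rw [Submodule.finrank_eq_zero, LinearMap.range_eq_bot] at h0
  have h5 : vecMulVec x (star x) = 0 := by
    apply Matrix.toLin'.injective
    rw [map_zero]
    exact h0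
  have h6 : kb x = 0 := h5
  rw [h6] at h
  simp at h

theorem pure_exists {m : ℕ} {A : Matrix (Fin m) (Fin m) ℂ} (h : IsPureState A) :
    ∃ x, A = kb x ∧ (kb x).trace = 1 := by
  obtain ⟨h1, h2, h3⟩ := h
  have hm := rank_one_minor h2
  have hs : ∀ a b, star (A b a) = A a b := fun a b => h1.apply a b
  have hsq : ∀ a b, ∑ c, A a c * A c b = A a b := by
    intro a b
    have : ∀ c, A a c * A c b = A a b * A c c := fun c => hm a c c b
    simp_rw [this, ← Finset.mul_sum]
    have h3' : ∑ c, A c c = 1 := h3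
    rw [h3', mul_one]
  obtain ⟨a, ha⟩ : ∃ a, A a a ≠ 0 := by
    by_contra! hc
    simp [Matrix.trace, hc] at h3
  have haa : A a a = ((∑ c, ‖A a c‖ ^ 2 : ℝ) : ℂ) := by
    rw [← hsq a a]
    push_cast
    refine Finset.sum_congr rfl fun c _ => ?_
    rw [← hs c a]
    simp [Complex.mul_conj']
  set r : ℝ := ∑ c, ‖A a c‖ ^ 2 with hr
  have hr0 : 0 ≤ r := Finset.sum_nonneg fun _ _ => by positivity
  have hrne : r ≠ 0 := by
    intro h; apply ha; rw [haa, h]; simp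
  have hsr : ((Real.sqrt r : ℝ) : ℂ) * (Real.sqrt r : ℝ) = r := by
    rw [← Complex.ofReal_mul, Real.mul_self_sqrt hr0]
  have hsr0 : ((Real.sqrt r : ℝ) : ℂ) ≠ 0 := by
    intro h; rw [h, zero_mul] at hsr; exact hrne (by exact_mod_cast hsr.symm)
  have hA : A = kb (fun b => A b a / (Real.sqrt r : ℝ)) := by
    ext b c
    have h4 := hm a a b c
    rw [kb_apply]
    have hq : star ((Real.sqrt r : ℝ) : ℂ) = (Real.sqrt r : ℝ) := Complex.conj_ofReal _
    rw [star_div₀, hs, hq]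
    rw [div_mul_div_comm, hsr, eq_div_iff (by exact_mod_cast hrne), ← haa]
    linear_combination h4
  exact ⟨_, hA, by rw [← hA]; exact h3⟩

theorem kb_smul {m : ℕ} (c : ℂ) (x : Fin m → ℂ) : kb (c • x) = (c * star c) • kb x := by
  ext a b
  simp [kb_apply]; ring

theorem kb_trace_pos {m : ℕ} {x : Fin m → ℂ} (hx : x ≠ 0) : 0 < ∑ a, ‖x a‖ ^ 2 := by
  obtain ⟨a, ha⟩ := Function.ne_iff.mp hx
  refine Finset.sum_pos' (fun _ _ => by positivity) ⟨a, Finset.mem_univ _, ?_⟩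
  have : 0 < ‖x a‖ := norm_pos_iff.mpr ha
  positivity

/-- every nonzero outer product is a positive multiple of a pure state -/
theorem kb_scale {m : ℕ} {x : Fin m → ℂ} (hx : x ≠ 0) :
    ∃ (r : ℝ) (P : Matrix (Fin m) (Fin m) ℂ), 0 < r ∧ IsPureState P ∧ kb x = (r : ℂ) • P ∧
      (kb x).trace = r := by
  have hp := kb_trace_pos hx
  set r := ∑ a, ‖x a‖ ^ 2 with hr
  have hrc : (r : ℂ) ≠ 0 := by exact_mod_cast hp.ne'
  have h1 : kb ((((Real.sqrt r)⁻¹ : ℝ) : ℂ) • x) = (r : ℂ)⁻¹ • kb x := by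
    rw [kb_smul]
    congr 1
    rw [Complex.star_def, Complex.conj_ofReal, ← Complex.ofReal_mul, ← mul_inv,
      Real.mul_self_sqrt hp.le]
    simp
  refine ⟨r, _, hp, kb_pure (x := (((Real.sqrt r)⁻¹ : ℝ) : ℂ) • x) ?_, ?_, ?_⟩
  · rw [h1, trace_smul, kb_trace, ← hr, smul_eq_mul, inv_mul_cancel₀ hrc]
  · rw [h1, smul_smul, mul_inv_cancel₀ hrc, one_smul]
  · rw [kb_trace]

theorem polar {m : ℕ} (x w : Fin m → ℂ) :
    (4 : ℂ) • vecMulVec x (star w) = kb (x + w) - kb (x - w) +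
      Complex.I • kb (x + Complex.I • w) - Complex.I • kb (x - Complex.I • w) := by
  ext a b
  simp [kb_apply, vecMulVec_apply]
  ring_nf
  simp
  ring

/-- Linear maps agreeing on outer products agree. -/
theorem ext_kb {m : ℕ} {V : Type*} [AddCommGroup V] [Module ℂ V]
    {f g : Matrix (Fin m) (Fin m) ℂ →ₗ[ℂ] V} (h : ∀ x, f (kb x) = g (kb x)) : f = g := by
  have h1 : ∀ x w, f (vecMulVec x (star w)) = g (vecMulVec x (star w)) := by
    intro x w
    have : (4 : ℂ) • f (vecMulVec x (star w)) = (4 : ℂ) • g (vecMulVec x (star w)) := by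
      rw [← map_smul, ← map_smul, polar]
      simp only [map_add, map_sub, map_smul, h]
    exact smul_right_injective V (by norm_num : (4 : ℂ) ≠ 0) this
  ext M
  rw [matrix_eq_sum_single M]
  simp only [map_sum]
  refine Finset.sum_congr rfl fun i _ => Finset.sum_congr rfl fun j _ => ?_
  have h2 : Matrix.single i j (M i j) = M i j • vecMulVec (Pi.single i 1) (star (Pi.single j 1)) := by
    rw [← Pi.single_star, star_one, ← single_eq_single_vecMulVec_single, smul_single, smul_eq_mul,
      mul_one]
  rw [h2, map_smul, map_smul, h1]

theorem ext_pure {m : ℕ} {V : Type*} [AddCommGroup V] [Module ℂ V]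
    {f g : Matrix (Fin m) (Fin m) ℂ →ₗ[ℂ] V} (h : ∀ P, IsPureState P → f P = g P) : f = g := by
  refine ext_kb fun x => ?_
  by_cases hx : x = 0
  · subst hx
    have : kb (0 : Fin m → ℂ) = 0 := by ext a b; simp [kb_apply]
    rw [this, map_zero, map_zero]
  · obtain ⟨r, P, -, hP, hr, -⟩ := kb_scale hx
    rw [hr, map_smul, map_smul, h P hP]

theorem span_pure (m : ℕ) :
    Submodule.span ℂ {P : Matrix (Fin m) (Fin m) ℂ | IsPureState P} = ⊤ := by
  rw [← Submodule.ker_mkQ (Submodule.span ℂ {P : Matrix (Fin m) (Fin m) ℂ | IsPureState P}),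
    LinearMap.ker_eq_top]
  refine ext_pure fun P hP => ?_
  simp only [Submodule.mkQ_apply, LinearMap.zero_apply, Submodule.Quotient.mk_eq_zero]
  exact Submodule.subset_span hP

theorem exists_pure {m : ℕ} (hm : 0 < m) : ∃ P : Matrix (Fin m) (Fin m) ℂ, IsPureState P := by
  have : (Pi.single ⟨0, hm⟩ 1 : Fin m → ℂ) ≠ 0 := by simp
  obtain ⟨r, P, -, hP, -⟩ := kb_scale this
  exact ⟨P, hP⟩

theorem frob {ι : Type*} [Fintype ι] (A : Matrix ι ι ℂ) :
    ∃ s : ℝ, (A * Aᴴ).trace = s ∧ 0 ≤ s ∧ (s ≤ 0 → A = 0) := by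
  have h1 : (A * Aᴴ).trace = ((∑ a, ∑ b, ‖A a b‖ ^ 2 : ℝ) : ℂ) := by
    simp only [Matrix.trace, diag_apply, mul_apply, conjTranspose_apply]
    push_cast
    refine Finset.sum_congr rfl fun a _ => Finset.sum_congr rfl fun b _ => ?_
    rw [Complex.star_def, Complex.mul_conj']
  have h0 : 0 ≤ ∑ a, ∑ b, ‖A a b‖ ^ 2 :=
    Finset.sum_nonneg fun _ _ => Finset.sum_nonneg fun _ _ => by positivity
  refine ⟨_, h1, h0, fun h => ?_⟩
  have h2 := le_antisymm h h0
  ext a b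
  rw [Finset.sum_eq_zero_iff_of_nonneg (fun _ _ => Finset.sum_nonneg fun _ _ => by positivity)] at h2
  have h3 := h2 a (Finset.mem_univ _)
  rw [Finset.sum_eq_zero_iff_of_nonneg (fun _ _ => by positivity)] at h3
  have h4 := h3 b (Finset.mem_univ _)
  simpa using h4

theorem pure_sq {m : ℕ} {P : Matrix (Fin m) (Fin m) ℂ} (hP : IsPureState P) :
    (P * P).trace = 1 := by
  obtain ⟨z, rfl, hz⟩ := pure_exists hP
  have : kb z * kb z = (kb z).trace • kb z := by
    ext a b
    simp only [mul_apply, kb_apply, Matrix.smul_apply, Matrix.trace, diag_apply, smul_eq_mul,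
      Finset.sum_mul]
    refine Finset.sum_congr rfl fun c _ => by ring
  rw [this, hz, one_smul, hz]

/-- overlap of two pure states -/
theorem pure_overlap {m : ℕ} {P Q : Matrix (Fin m) (Fin m) ℂ} (hP : IsPureState P)
    (hQ : IsPureState Q) : ∃ t : ℝ, (P * Q).trace = t ∧ t ≤ 1 ∧ (t = 1 → P = Q) := by
  obtain ⟨s, h1, hs0, hs1⟩ := frob (P - Q)
  have h2 : ((P - Q) * (P - Q)ᴴ).trace = 2 - 2 * (P * Q).trace := by
    rw [conjTranspose_sub, hP.1.eq, hQ.1.eq, sub_mul, mul_sub, mul_sub]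
    simp only [trace_sub, pure_sq hP, pure_sq hQ, trace_mul_comm Q P]
    ring
  refine ⟨1 - s / 2, ?_, by linarith, fun h => ?_⟩
  · push_cast
    rw [← h1, h2]; ring
  · exact sub_eq_zero.mp (hs1 (by linarith))

end PNR

namespace PNR

/-- Hamming adjacency -/
def HAdj {ι : Type*} {X : ι → Type*} (Q Q' : ∀ i, X i) : Prop :=
  ∃ i, Q i ≠ Q' i ∧ ∀ j, j ≠ i → Q j = Q' j

theorem hamming_prop {ι : Type*} [DecidableEq ι] [Fintype ι] {X : ι → Type*} {Y : Type*}
    (g : (∀ i, X i) → Y) (p : ι → Prop)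
    (hg : ∀ Q i b, p i → g (Function.update Q i b) = g Q)
    {Q Q' : ∀ i, X i} (hQ : ∀ i, ¬ p i → Q i = Q' i) : g Q = g Q' := by
  have key : ∀ s : Finset ι, g (s.piecewise Q' Q) = g Q := by
    intro s
    induction s using Finset.induction_on with
    | empty => simp
    | insert j s hj ih =>
      rw [Finset.piecewise_insert]
      by_cases hp : p j
      · rw [hg _ _ _ hp, ih]
      · have : Q' j = s.piecewise Q' Q j := by
          rw [Finset.piecewise_eq_of_notMem _ _ _ hj, hQ j hp]
        rw [this, Function.update_eq_self, ih]
  have := key Finset.univ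
  rw [Finset.piecewise_univ] at this
  exact this.symm

theorem hamming_aut {ι : Type*} [DecidableEq ι] [Fintype ι] {X : ι → Type*}
    [∀ i, Nontrivial (X i)] (F : (∀ i, X i) → (∀ i, X i)) (hinj : Function.Injective F)
    (h1 : ∀ Q Q', HAdj Q Q' → HAdj (F Q) (F Q')) (h2 : ∀ Q Q', HAdj (F Q) (F Q') → HAdj Q Q') :
    ∃ (π : Equiv.Perm ι) (f : ∀ j, X (π j) → X j), ∀ Q j, F Q j = f j (Q (π j)) := by
  have hupd : ∀ (Q : ∀ i, X i) i a b, a ≠ b →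
      HAdj (Function.update Q i a) (Function.update Q i b) := by
    intro Q i a b hab
    refine ⟨i, by simpa using hab, fun j hj => ?_⟩
    rw [Function.update_of_ne hj, Function.update_of_ne hj]
  have hupd' : ∀ (Q : ∀ i, X i) i a, a ≠ Q i → HAdj Q (Function.update Q i a) := by
    intro Q i a h
    have := hupd Q i (Q i) a h.symm
    rwa [Function.update_eq_self] at this
  have hd : ∀ (Q : ∀ i, X i) i, ∃ j, ∀ a l, l ≠ j → F (Function.update Q i a) l = F Q l := by
    intro Q i
    obtain ⟨a0, ha0⟩ := exists_ne (Q i)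
    obtain ⟨j, hj, hj'⟩ := h1 _ _ (hupd' Q i a0 ha0)
    refine ⟨j, fun a l hl => ?_⟩
    by_cases ha : a = Q i
    · rw [ha, Function.update_eq_self]
    by_cases ha' : a = a0
    · rw [ha', hj' l hl]
    obtain ⟨j1, hj1, hj1'⟩ := h1 _ _ (hupd' Q i a ha)
    obtain ⟨j2, hj2, hj2'⟩ := h1 _ _ (hupd Q i a a0 ha')
    have : j1 = j := by
      by_contra hne
      have e1 : j2 = j := by
        by_contra hc
        apply hj
        rw [hj1' j (Ne.symm hne), hj2' j (Ne.symm hc)]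
      have e2 : j2 = j1 := by
        by_contra hc
        apply hj1
        rw [hj' j1 hne, hj2' j1 (Ne.symm hc)]
      exact hne (e2.symm.trans e1)
    subst this
    exact (hj1' l hl).symm
  choose d hd using hd
  have hdne : ∀ (Q : ∀ i, X i) i a, a ≠ Q i →
      F (Function.update Q i a) (d Q i) ≠ F Q (d Q i) := by
    intro Q i a ha h
    have : F (Function.update Q i a) = F Q := by
      funext l
      by_cases hl : l = d Q i
      · rw [hl, h]
      · exact hd Q i a l hl
    have := congrFun (hinj this) i
    simp at this
    exact ha this
  have hduniq : ∀ (Q : ∀ i, X i) i a l, F (Function.update Q i a) l ≠ F Q l → l = d Q i := by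
    intro Q i a l h
    by_contra hc
    exact h (hd Q i a l hc)
  have hdinj : ∀ (Q : ∀ i, X i) i i', i ≠ i' → d Q i ≠ d Q i' := by
    intro Q i i' hne heq
    obtain ⟨a, ha⟩ := exists_ne (Q i)
    obtain ⟨b, hb⟩ := exists_ne (Q i')
    have e1 := hd Q i a
    have e2 := hd Q i' b
    by_cases hj : F (Function.update Q i a) (d Q i) = F (Function.update Q i' b) (d Q i)
    · have : F (Function.update Q i a) = F (Function.update Q i' b) := by
        funext l
        by_cases hl : l = d Q i
        · rw [hl, hj]
        · rw [e1 l hl, e2 l (heq ▸ hl)]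
      have := congrFun (hinj this) i
      rw [Function.update_self, Function.update_of_ne hne] at this
      exact ha this
    · obtain ⟨m, hm, hm'⟩ := h2 _ _ ⟨d Q i, hj, fun l hl => by rw [e1 l hl, e2 l (heq ▸ hl)]⟩
      have f1 : i = m := by
        by_contra hc
        have := hm' i hc
        rw [Function.update_self, Function.update_of_ne hne] at this
        exact ha this
      have f2 : i' = m := by
        by_contra hc
        have := hm' i' hc
        rw [Function.update_self, Function.update_of_ne hne.symm] at this
        exact hb this.symm
      exact hne (f1.trans f2.symm)
  have hsame : ∀ (Q : ∀ i, X i) i b, d (Function.update Q i b) i = d Q i := by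
    intro Q i b
    by_cases hb : b = Q i
    · rw [hb, Function.update_eq_self]
    symm
    apply hduniq _ _ (Q i)
    rw [Function.update_idem, Function.update_eq_self]
    exact (hdne Q i b hb).symm
  have hconst : ∀ (Q : ∀ i, X i) i i' b, d (Function.update Q i' b) i = d Q i := by
    intro Q i i' b
    by_cases hii : i' = i
    · subst hii; exact hsame Q i' b
    by_cases hb : b = Q i'
    · rw [hb, Function.update_eq_self]
    by_contra hne
    set Q' := Function.update Q i' b with hQ'
    have l1 : d Q i ≠ d Q i' := hdinj Q _ _ (Ne.symm hii)
    have l2 : d Q' i ≠ d Q i' := by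
      have := hdinj Q' i i' (Ne.symm hii)
      rwa [hQ', hsame Q i' b, ← hQ'] at this
    obtain ⟨a, ha⟩ := exists_ne (Q i)
    have ha' : a ≠ Q' i := by rwa [hQ', Function.update_of_ne (Ne.symm hii)]
    have hadj : HAdj (Function.update Q i a) (Function.update Q' i a) := by
      rw [hQ', Function.update_comm hii]
      apply hupd'
      rwa [Function.update_of_ne hii]
    obtain ⟨m, hm, hm'⟩ := h1 _ _ hadj
    have f1 : d Q i' = m := by
      by_contra hc
      have := hm' _ hc
      rw [hd Q i a _ l1.symm, hd Q' i a _ l2.symm] at this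
      exact hdne Q i' b hb this.symm
    have f2 : d Q i = m := by
      by_contra hc
      have := hm' _ hc
      rw [hd Q' i a _ (Ne.symm hne), hQ', hd Q i' b _ l1] at this
      exact hdne Q i a ha this
    exact l1 (f2.trans f1.symm)
  obtain ⟨Q0⟩ : Nonempty (∀ i, X i) := inferInstance
  have hall : ∀ Q i, d Q i = d Q0 i := by
    intro Q i
    exact hamming_prop (fun Q => d Q i) (fun _ => True) (fun Q i' b _ => hconst Q i i' b)
      (fun i h => absurd trivial h)
  have hbij : Function.Bijective (d Q0) := by
    apply Function.Injective.bijective_of_finite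
    intro i i' h
    by_contra hc
    exact hdinj Q0 i i' hc h
  let σ : Equiv.Perm ι := Equiv.ofBijective _ hbij
  refine ⟨σ.symm, fun j a => F (Function.update Q0 (σ.symm j) a) j, fun Q j => ?_⟩
  refine hamming_prop (fun Q => F Q j) (fun i => i ≠ σ.symm j) ?_ ?_
  · intro Q i b hi
    apply hd
    rw [hall]
    intro h
    apply hi
    rw [Equiv.eq_symm_apply]
    exact h.symm
  · intro i hi
    rw [not_not] at hi
    subst hi
    simp

end PNR

namespace PNR

theorem tensorPi_apply {k : ℕ} {n : Fin k → ℕ} (A : ∀ i, Matrix (Fin (n i)) (Fin (n i)) ℂ)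
    (x y : ∀ i, Fin (n i)) : tensorPi A x y = ∏ i, A i (x i) (y i) := rfl

theorem tensorPi_trace_mul {k : ℕ} {n : Fin k → ℕ} (A B : ∀ i, Matrix (Fin (n i)) (Fin (n i)) ℂ) :
    (tensorPi A * tensorPi B).trace = ∏ i, (A i * B i).trace := by
  simp only [Matrix.trace, diag_apply, mul_apply, tensorPi_apply]
  simp only [← Finset.prod_mul_distrib]
  have h1 : ∀ x : ∀ i, Fin (n i), ∑ y : ∀ i, Fin (n i), ∏ i, A i (x i) (y i) * B i (y i) (x i)
      = ∏ i, ∑ c, A i (x i) c * B i c (x i) := by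
    intro x
    rw [Finset.prod_univ_sum, Fintype.piFinset_univ]
  simp only [h1]
  rw [Finset.prod_univ_sum, Fintype.piFinset_univ]

theorem tensorPi_conj {k : ℕ} {n : Fin k → ℕ} (A : ∀ i, Matrix (Fin (n i)) (Fin (n i)) ℂ) :
    (tensorPi A)ᴴ = tensorPi fun i => (A i)ᴴ := by
  ext x y
  simp [tensorPi_apply, conjTranspose_apply]

theorem tensorPi_pure_conj {k : ℕ} {n : Fin k → ℕ} {A : ∀ i, Matrix (Fin (n i)) (Fin (n i)) ℂ}
    (h : ∀ i, IsPureState (A i)) : (tensorPi A)ᴴ = tensorPi A := by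
  rw [tensorPi_conj]
  congr 1
  funext i
  exact (h i).1.eq

/-- tensor product as a multilinear map -/
noncomputable def tM {k : ℕ} (n : Fin k → ℕ) :
    MultilinearMap ℂ (fun i => Matrix (Fin (n i)) (Fin (n i)) ℂ)
      (Matrix (∀ i, Fin (n i)) (∀ i, Fin (n i)) ℂ) :=
  MultilinearMap.pi fun x => MultilinearMap.pi fun y =>
    (MultilinearMap.mkPiAlgebra ℂ (Fin k) ℂ).compLinearMap
      fun i => Matrix.entryLinearMap ℂ ℂ (x i) (y i)

theorem tM_apply {k : ℕ} {n : Fin k → ℕ} (A : ∀ i, Matrix (Fin (n i)) (Fin (n i)) ℂ) :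
    tM n A = tensorPi A := by
  ext x y
  rw [tensorPi_apply]
  exact MultilinearMap.mkPiAlgebra_apply (R := ℂ) (A := ℂ) (fun i => A i (x i) (y i))

theorem multi_ext_pure {k : ℕ} {n : Fin k → ℕ} {V : Type*} [AddCommGroup V] [Module ℂ V]
    {f g : MultilinearMap ℂ (fun i => Matrix (Fin (n i)) (Fin (n i)) ℂ) V}
    (h : ∀ Q : ∀ i, Matrix (Fin (n i)) (Fin (n i)) ℂ, (∀ i, IsPureState (Q i)) → f Q = g Q) :
    f = g := by
  refine Module.Basis.ext_multilinear (fun i => Module.Basis.ofSpan (span_pure (n i)).ge) ?_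
  intro v
  apply h
  intro i
  exact Module.Basis.ofSpan_subset (span_pure (n i)).ge (Set.mem_range_self _)

/-- product pure states span -/
theorem span_prod {k : ℕ} {n : Fin k → ℕ}
    (p : Submodule ℂ (Matrix (∀ i, Fin (n i)) (∀ i, Fin (n i)) ℂ))
    (h : ∀ Q : ∀ i, Matrix (Fin (n i)) (Fin (n i)) ℂ, (∀ i, IsPureState (Q i)) → tensorPi Q ∈ p) :
    p = ⊤ := by
  have h1 : p.mkQ.compMultilinearMap (tM n) = 0 := by
    apply multi_ext_pure
    intro Q hQ
    simp [tM_apply, h Q hQ]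
  have h2 : ∀ A : ∀ i, Matrix (Fin (n i)) (Fin (n i)) ℂ, tensorPi A ∈ p := by
    intro A
    have := congrArg (fun f => f A) h1
    simpa [tM_apply] using this
  rw [eq_top_iff]
  intro M _
  rw [matrix_eq_sum_single M]
  refine Submodule.sum_mem _ fun x _ => Submodule.sum_mem _ fun y _ => ?_
  have h3 : Matrix.single x y (M x y) = M x y • tensorPi fun i => Matrix.single (x i) (y i) 1 := by
    ext x' y'
    rw [Matrix.smul_apply, tensorPi_apply]
    simp only [Matrix.single_apply]
    by_cases hx : x = x' ∧ y = y'
    · obtain ⟨rfl, rfl⟩ := hx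
      simp
    · rw [if_neg hx]
      have : ∃ i, ¬ (x i = x' i ∧ y i = y' i) := by
        by_contra! hc
        exact hx ⟨funext fun i => (hc i).1, funext fun i => (hc i).2⟩
      obtain ⟨i, hi⟩ := this
      rw [Finset.prod_eq_zero (Finset.mem_univ i) (by rw [if_neg hi]), smul_zero]
  rw [h3]
  exact p.smul_mem _ (h2 _)

theorem hull_re {W : Set ℂ} {z : ℂ} (hz : z ∈ convexHull ℝ W) : ∃ w ∈ W, z.re ≤ w.re := by
  by_contra! hc
  have : convexHull ℝ W ⊆ {w | w.re < z.re} := convexHull_min hc (convex_halfSpace_re_lt _)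
  exact lt_irrefl z.re (this hz)

theorem adj_trace {k : ℕ} {n : Fin k → ℕ}
    {Ψ ΨStar : Matrix (∀ i, Fin (n i)) (∀ i, Fin (n i)) ℂ →ₗ[ℂ]
        Matrix (∀ i, Fin (n i)) (∀ i, Fin (n i)) ℂ}
    (hadj : ∀ X Y, (Ψ X * Yᴴ).trace = (X * (ΨStar Y)ᴴ).trace)
    {Q : ∀ i, Matrix (Fin (n i)) (Fin (n i)) ℂ} (hQ : ∀ i, IsPureState (Q i))
    (T : Matrix (∀ i, Fin (n i)) (∀ i, Fin (n i)) ℂ) :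
    (ΨStar T * tensorPi Q).trace = (T * (Ψ (tensorPi Q))ᴴ).trace := by
  have h := congrArg star (hadj (tensorPi Q) T)
  rw [← trace_conjTranspose, ← trace_conjTranspose, conjTranspose_mul, conjTranspose_mul,
    conjTranspose_conjTranspose, conjTranspose_conjTranspose, tensorPi_pure_conj hQ] at h
  exact h.symm

theorem step1 {k : ℕ} {n : Fin k → ℕ}
    {Ψ ΨStar : Matrix (∀ i, Fin (n i)) (∀ i, Fin (n i)) ℂ →ₗ[ℂ]
        Matrix (∀ i, Fin (n i)) (∀ i, Fin (n i)) ℂ}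
    (hadj : ∀ X Y, (Ψ X * Yᴴ).trace = (X * (ΨStar Y)ᴴ).trace)
    (hb : ∀ T, convexHull ℝ (prodNumRangePi (ΨStar T)) = convexHull ℝ (prodNumRangePi T))
    {Q : ∀ i, Matrix (Fin (n i)) (Fin (n i)) ℂ} (hQ : ∀ i, IsPureState (Q i)) :
    ∃ Q0 : ∀ i, Matrix (Fin (n i)) (Fin (n i)) ℂ, (∀ i, IsPureState (Q0 i)) ∧
      Ψ (tensorPi Q0) = tensorPi Q := by
  have hsq : ∀ {R : ∀ i, Matrix (Fin (n i)) (Fin (n i)) ℂ}, (∀ i, IsPureState (R i)) →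
      (tensorPi R * tensorPi R).trace = 1 := by
    intro R hR
    rw [tensorPi_trace_mul]
    exact Finset.prod_eq_one fun i _ => pure_sq (hR i)
  have hre : ∀ A B : Matrix (∀ i, Fin (n i)) (∀ i, Fin (n i)) ℂ,
      (A * Bᴴ).trace.re = (B * Aᴴ).trace.re := by
    intro A B
    have : (B * Aᴴ) = (A * Bᴴ)ᴴ := by
      rw [conjTranspose_mul, conjTranspose_conjTranspose]
    rw [this, trace_conjTranspose]; simp
  -- norm bound
  have hN : ∀ Q0 : ∀ i, Matrix (Fin (n i)) (Fin (n i)) ℂ, (∀ i, IsPureState (Q0 i)) →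
      (Ψ (tensorPi Q0) * (Ψ (tensorPi Q0))ᴴ).trace.re ≤ 1 := by
    intro Q0 hQ0
    set Y := Ψ (tensorPi Q0) with hY
    obtain ⟨s, hs, hs0, -⟩ := frob Y
    have h1 : (Y * Yᴴ).trace ∈ convexHull ℝ (prodNumRangePi Y) := by
      rw [← hb]
      apply subset_convexHull
      exact ⟨Q0, hQ0, (adj_trace hadj hQ0 Y).symm⟩
    obtain ⟨w, ⟨Q1, hQ1, rfl⟩, hw⟩ := hull_re h1
    obtain ⟨t, ht, ht0, -⟩ := frob (Y - (s : ℂ) • tensorPi Q1)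
    have h2 : ((Y - (s : ℂ) • tensorPi Q1) * (Y - (s : ℂ) • tensorPi Q1)ᴴ).trace.re =
        s + s * s - 2 * s * (Y * tensorPi Q1).trace.re := by
      have e1 : (Y - (s : ℂ) • tensorPi Q1)ᴴ = Yᴴ - (s : ℂ) • tensorPi Q1 := by
        rw [conjTranspose_sub, conjTranspose_smul, tensorPi_pure_conj hQ1]; simp
      rw [e1, sub_mul, mul_sub, mul_sub]
      simp only [trace_sub, smul_mul_assoc, mul_smul_comm, trace_smul, hsq hQ1, hs]
      have := hre (tensorPi Q1) Y
      rw [tensorPi_pure_conj hQ1] at this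
      simp [this]
      ring
    rw [ht, Complex.ofReal_re] at h2
    rw [hs, Complex.ofReal_re] at hw ⊢
    nlinarith
  have h1 : (1 : ℂ) ∈ convexHull ℝ (prodNumRangePi (ΨStar (tensorPi Q))) := by
    rw [hb]
    apply subset_convexHull
    exact ⟨Q, hQ, (hsq hQ).symm⟩
  obtain ⟨w, ⟨Q0, hQ0, rfl⟩, hw⟩ := hull_re h1
  rw [adj_trace hadj hQ0] at hw
  refine ⟨Q0, hQ0, ?_⟩
  have hn := hN Q0 hQ0
  set Y := Ψ (tensorPi Q0)
  obtain ⟨t, ht, ht0, ht1⟩ := frob (Y - tensorPi Q)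
  have h2 : ((Y - tensorPi Q) * (Y - tensorPi Q)ᴴ).trace.re =
      (Y * Yᴴ).trace.re + 1 - 2 * (tensorPi Q * Yᴴ).trace.re := by
    have := hre (tensorPi Q) Y
    rw [conjTranspose_sub, sub_mul, mul_sub, mul_sub]
    rw [tensorPi_pure_conj hQ] at this ⊢
    simp only [trace_sub, hsq hQ, Complex.sub_re, Complex.one_re]
    rw [← this]
    ring
  rw [ht, Complex.ofReal_re] at h2
  simp at hw
  exact sub_eq_zero.mp (ht1 (by linarith))

/-- defect of two pure states -/
noncomputable def dd {m : ℕ} (P Q : Matrix (Fin m) (Fin m) ℂ) : ℝ := 1 - (P * Q).trace.re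

theorem dd_spec {m : ℕ} {P Q : Matrix (Fin m) (Fin m) ℂ} (hP : IsPureState P)
    (hQ : IsPureState Q) : (P * (1 - Q)).trace = (dd P Q : ℂ) ∧ 0 ≤ dd P Q ∧ (dd P Q = 0 ↔ P = Q) := by
  obtain ⟨t, h1, h2, h3⟩ := pure_overlap hP hQ
  have h4 : dd P Q = 1 - t := by rw [dd, h1, Complex.ofReal_re]
  refine ⟨?_, by linarith, ?_, ?_⟩
  · rw [mul_sub, mul_one, trace_sub, hP.2.2, h1, h4]; simp
  · intro h; exact h3 (by linarith)
  · rintro rfl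
    rw [dd, pure_sq hP]; simp

theorem test_trace {k : ℕ} {n : Fin k → ℕ} {A : ∀ i, Matrix (Fin (n i)) (Fin (n i)) ℂ}
    (hA : ∀ i, IsPureState (A i)) {a b : Fin k} (hab : a ≠ b) {X : Matrix (Fin (n a)) (Fin (n a)) ℂ}
    {Y : Matrix (Fin (n b)) (Fin (n b)) ℂ} (hX : IsPureState X) (hY : IsPureState Y) :
    (tensorPi A * tensorPi (Function.update (Function.update (fun _ => 1) a (1 - X)) b (1 - Y))).trace
      = ((dd (A a) X * dd (A b) Y : ℝ) : ℂ) := by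
  rw [tensorPi_trace_mul, ← Finset.mul_prod_erase _ _ (Finset.mem_univ a),
    ← Finset.mul_prod_erase _ _ (Finset.mem_erase.mpr ⟨hab.symm, Finset.mem_univ b⟩),
    Finset.prod_eq_one, Function.update_self, Function.update_of_ne hab, Function.update_self,
    (dd_spec (hA a) hX).1, (dd_spec (hA b) hY).1]
  · push_cast; ring
  · intro i hi
    simp only [Finset.mem_erase] at hi
    rw [Function.update_of_ne hi.1, Function.update_of_ne hi.2.1, mul_one, (hA i).2.2]

theorem two_diff {k : ℕ} {n : Fin k → ℕ} {P Q R R' : ∀ i, Matrix (Fin (n i)) (Fin (n i)) ℂ}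
    (hP : ∀ i, IsPureState (P i)) (hQ : ∀ i, IsPureState (Q i))
    (hR : ∀ i, IsPureState (R i)) (hR' : ∀ i, IsPureState (R' i)) {s t : ℝ} (hs : 0 < s)
    (ht : 0 ≤ t) (h : tensorPi P + tensorPi Q = (s : ℂ) • tensorPi R + (t : ℂ) • tensorPi R')
    {a b : Fin k} (hab : a ≠ b) (ha : P a ≠ Q a) (hb : P b ≠ Q b) : R = P ∨ R = Q := by
  have key : ∀ {c d : Fin k}, c ≠ d → ∀ {X : Matrix (Fin (n c)) (Fin (n c)) ℂ}
      {Y : Matrix (Fin (n d)) (Fin (n d)) ℂ}, IsPureState X → IsPureState Y →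
      (P c = X ∨ P d = Y) → (Q c = X ∨ Q d = Y) → (R c = X ∨ R d = Y) := by
    intro c d hcd X Y hX hY h1 h2
    have h3 := congrArg (fun M => (M * tensorPi (Function.update (Function.update (fun _ => 1) c
      (1 - X)) d (1 - Y))).trace) h
    simp only [add_mul, trace_add, smul_mul_assoc, trace_smul, test_trace hP hcd hX hY,
      test_trace hQ hcd hX hY, test_trace hR hcd hX hY, test_trace hR' hcd hX hY, smul_eq_mul] at h3
    norm_cast at h3
    have e1 : dd (P c) X * dd (P d) Y = 0 := by
      rw [mul_eq_zero, (dd_spec (hP c) hX).2.2, (dd_spec (hP d) hY).2.2]; exact h1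
    have e2 : dd (Q c) X * dd (Q d) Y = 0 := by
      rw [mul_eq_zero, (dd_spec (hQ c) hX).2.2, (dd_spec (hQ d) hY).2.2]; exact h2
    have e3 : 0 ≤ dd (R c) X * dd (R d) Y :=
      mul_nonneg (dd_spec (hR c) hX).2.1 (dd_spec (hR d) hY).2.1
    have e4 : 0 ≤ t * (dd (R' c) X * dd (R' d) Y) :=
      mul_nonneg ht (mul_nonneg (dd_spec (hR' c) hX).2.1 (dd_spec (hR' d) hY).2.1)
    have e5 : s * (dd (R c) X * dd (R d) Y) = 0 := by
      have := mul_nonneg hs.le e3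
      rw [e1, e2] at h3
      linarith
    have e6 : dd (R c) X * dd (R d) Y = 0 := by
      rcases mul_eq_zero.mp e5 with h | h
      · exact absurd h hs.ne'
      · exact h
    rwa [mul_eq_zero, (dd_spec (hR c) hX).2.2, (dd_spec (hR d) hY).2.2] at e6
  by_cases hRa : R a = P a
  · left
    funext c
    by_cases hc : c = a
    · rw [hc, hRa]
    · rcases key (Ne.symm hc) (hQ a) (hP c) (Or.inr rfl) (Or.inl rfl) with h | h
      · exact absurd (hRa.symm.trans h) ha
      · exact h
  · right
    have h1 : ∀ c, c ≠ a → R c = Q c := by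
      intro c hc
      rcases key (Ne.symm hc) (hP a) (hQ c) (Or.inl rfl) (Or.inr rfl) with h | h
      · exact absurd h hRa
      · exact h
    funext c
    by_cases hc : c = a
    · rw [hc]
      rcases key hab (hQ a) (hP b) (Or.inr rfl) (Or.inl rfl) with h | h
      · exact h
      · rw [h1 b hab.symm] at h
        exact absurd h.symm hb
    · exact h1 c hc

end PNR

namespace PNR

abbrev PureSt (m : ℕ) : Type := {A : Matrix (Fin m) (Fin m) ℂ // IsPureState A}

def toT {k : ℕ} {n : Fin k → ℕ} (Q : ∀ i, PureSt (n i)) :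
    Matrix (∀ i, Fin (n i)) (∀ i, Fin (n i)) ℂ := tensorPi fun i => (Q i).1

theorem test_trace1 {k : ℕ} {n : Fin k → ℕ} {A : ∀ i, Matrix (Fin (n i)) (Fin (n i)) ℂ}
    (hA : ∀ i, IsPureState (A i)) {a : Fin k} {X : Matrix (Fin (n a)) (Fin (n a)) ℂ}
    (hX : IsPureState X) :
    (tensorPi A * tensorPi (Function.update (fun _ => 1) a (1 - X))).trace
      = (dd (A a) X : ℂ) := by
  rw [tensorPi_trace_mul, ← Finset.mul_prod_erase _ _ (Finset.mem_univ a),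
    Finset.prod_eq_one, Function.update_self, (dd_spec (hA a) hX).1, mul_one]
  intro i hi
  simp only [Finset.mem_erase] at hi
  rw [Function.update_of_ne hi.1, mul_one, (hA i).2.2]

theorem toT_inj {k : ℕ} {n : Fin k → ℕ} : Function.Injective (toT (n := n)) := by
  intro P Q h
  funext a
  have h1 := test_trace1 (fun i => (P i).2) (Q a).2
  have h2 := test_trace1 (fun i => (Q i).2) (Q a).2
  have h3 : tensorPi (fun i => (P i).1) = tensorPi (fun i => (Q i).1) := h
  rw [h3, h2] at h1
  have h4 := Complex.ofReal_injective h1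
  rw [(dd_spec (Q a).2 (Q a).2).2.2.mpr rfl] at h4
  exact Subtype.ext ((dd_spec (P a).2 (Q a).2).2.2.mp h4.symm)

theorem kb_par {m : ℕ} {p q : Fin m → ℂ} {c : ℂ} (h : kb p = c • kb q) (hp : p ≠ 0) :
    ∃ t : ℂ, p = t • q := by
  obtain ⟨b, hb⟩ := Function.ne_iff.mp hp
  have hb' : star (p b) ≠ 0 := star_ne_zero.mpr hb
  refine ⟨c * star (q b) / star (p b), ?_⟩
  funext a
  have := congrFun (congrFun h a) b
  rw [Matrix.smul_apply, kb_apply, kb_apply, smul_eq_mul] at this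
  rw [Pi.smul_apply, smul_eq_mul, div_mul_eq_mul_div, eq_div_iff hb', this]
  ring

theorem kb_eq_of_par {m : ℕ} {x y : Fin m → ℂ} (hx : (kb x).trace = 1) (hy : (kb y).trace = 1)
    {t : ℂ} (h : y = t • x) : kb x = kb y := by
  subst h
  rw [kb_smul, trace_smul, hx, smul_eq_mul, mul_one] at hy
  rw [kb_smul, hy, one_smul]

theorem adj_lemma {k : ℕ} {n : Fin k → ℕ}
    (Ψ : Matrix (∀ i, Fin (n i)) (∀ i, Fin (n i)) ℂ →ₗ[ℂ]
        Matrix (∀ i, Fin (n i)) (∀ i, Fin (n i)) ℂ)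
    (F : (∀ i, PureSt (n i)) → (∀ i, PureSt (n i))) (hinj : Function.Injective F)
    (hF : ∀ Q, Ψ (toT Q) = toT (F Q)) {Q Q' : ∀ i, PureSt (n i)} (h : HAdj Q Q') :
    HAdj (F Q) (F Q') := by
  obtain ⟨i, hi, hj⟩ := h
  have hne : F Q ≠ F Q' := fun h => hi (congrFun (hinj h) i)
  obtain ⟨a, ha⟩ := Function.ne_iff.mp hne
  refine ⟨a, ha, fun b hb => ?_⟩
  by_contra hbne
  obtain ⟨x, hx, hx1⟩ := pure_exists (Q i).2
  obtain ⟨y, hy, hy1⟩ := pure_exists (Q' i).2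
  have hxy : kb x ≠ kb y := fun h => hi (Subtype.ext (by rw [hx, hy, h]))
  have hp : x + y ≠ 0 := by
    intro h
    exact hxy (kb_eq_of_par hx1 hy1 (t := -1) (by
      rw [neg_smul, one_smul]; exact (neg_eq_of_add_eq_zero_right h).symm))
  have hm : x - y ≠ 0 := by
    intro h
    exact hxy (by rw [sub_eq_zero.mp h])
  obtain ⟨r, P, hr, hP, hrP, -⟩ := kb_scale hp
  obtain ⟨s, P', hs, hP', hsP, -⟩ := kb_scale hm
  have hPx : P ≠ kb x := by
    intro h
    rw [h] at hrP
    obtain ⟨t, ht⟩ := kb_par hrP hp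
    exact hxy (kb_eq_of_par hx1 hy1 (t := t - 1) (by rw [sub_smul, one_smul, ← ht]; simp))
  have hPy : P ≠ kb y := by
    intro h
    rw [h] at hrP
    obtain ⟨t, ht⟩ := kb_par hrP hp
    exact hxy (kb_eq_of_par hy1 hx1 (t := t - 1) (by rw [sub_smul, one_smul, ← ht]; simp)).symm
  let W : ∀ i, PureSt (n i) := Function.update Q i ⟨P, hP⟩
  let W' : ∀ i, PureSt (n i) := Function.update Q i ⟨P', hP'⟩
  have hupd : ∀ (Z : ∀ i, PureSt (n i)) (hZ : ∀ j, j ≠ i → Q j = Z j),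
      toT Z = tM n (Function.update (fun i => (Q i).1) i (Z i).1) := by
    intro Z hZ
    rw [tM_apply, toT]
    congr 1
    funext l
    by_cases hl : l = i
    · subst hl; simp
    · rw [Function.update_of_ne hl, hZ l hl]
  have e : toT Q + toT Q' = ((r / 2 : ℝ) : ℂ) • toT W + ((s / 2 : ℝ) : ℂ) • toT W' := by
    rw [hupd Q (fun _ _ => rfl), hupd Q' hj, hupd W (fun j hj => by simp [W, hj]),
      hupd W' (fun j hj => by simp [W', hj])]
    have hWi : (W i).1 = P := by simp [W]
    have hWi' : (W' i).1 = P' := by simp [W']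
    rw [hWi, hWi', ← MultilinearMap.map_update_smul, ← MultilinearMap.map_update_smul,
      ← MultilinearMap.map_update_add, ← MultilinearMap.map_update_add]
    congr 2
    have h1 : ((r / 2 : ℝ) : ℂ) • P = (1 / 2 : ℂ) • kb (x + y) := by
      rw [hrP, smul_smul]; congr 1; push_cast; ring
    have h2 : ((s / 2 : ℝ) : ℂ) • P' = (1 / 2 : ℂ) • kb (x - y) := by
      rw [hsP, smul_smul]; congr 1; push_cast; ring
    rw [h1, h2, hx, hy]
    ext c d
    simp [kb_apply]
    ring
  have e' := congrArg Ψ e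
  simp only [map_add, map_smul, hF] at e'
  have := two_diff (fun i => (F Q i).2) (fun i => (F Q' i).2) (fun i => (F W i).2)
    (fun i => (F W' i).2) (by positivity : 0 < r / 2) (by positivity : 0 ≤ s / 2) e'
    (Ne.symm hb) (fun h => ha (Subtype.ext h)) (fun h => hbne (Subtype.ext h))
  rcases this with h | h
  · have h2 : F W = F Q := funext fun i => Subtype.ext (congrFun h i)
    have h3 := congrFun (hinj h2) i
    apply hPx
    rw [← hx, ← h3]; simp [W]
  · have h2 : F W = F Q' := funext fun i => Subtype.ext (congrFun h i)
    have h3 := congrFun (hinj h2) i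
    apply hPy
    rw [← hy, ← h3]; simp [W]

theorem pureSt_nontrivial {m : ℕ} (h : 2 ≤ m) : Nontrivial (PureSt m) := by
  let e (i : Fin m) : Fin m → ℂ := Pi.single i 1
  have h1 : ∀ i, IsPureState (kb (e i)) := by
    intro i
    apply kb_pure
    simp [Matrix.trace, kb_apply, e, Pi.single_apply]
  refine ⟨⟨⟨_, h1 ⟨0, by omega⟩⟩, ⟨_, h1 ⟨1, by omega⟩⟩, ?_⟩⟩
  intro h
  have := congrFun (congrFun (congrArg Subtype.val h) ⟨0, by omega⟩) ⟨0, by omega⟩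
  simp [kb_apply, e, Pi.single_apply] at this

theorem slice {k : ℕ} {n : Fin k → ℕ} (B : ∀ i, Matrix (Fin (n i)) (Fin (n i)) ℂ)
    (x : ∀ i, Fin (n i)) (i : Fin k) (a b : Fin (n i)) :
    tensorPi B (Function.update x i a) (Function.update x i b) =
      B i a b * ∏ l ∈ Finset.univ.erase i, B l (x l) (x l) := by
  rw [tensorPi_apply, ← Finset.mul_prod_erase _ _ (Finset.mem_univ i), Function.update_self,
    Function.update_self]
  congr 1
  refine Finset.prod_congr rfl fun l hl => ?_
  rw [Function.update_of_ne (Finset.ne_of_mem_erase hl),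
    Function.update_of_ne (Finset.ne_of_mem_erase hl)]

theorem pure_diag {m : ℕ} {P : Matrix (Fin m) (Fin m) ℂ} (h : IsPureState P) :
    ∃ a, P a a ≠ 0 := by
  by_contra! hc
  have := h.2.2
  simp [Matrix.trace, hc] at this

theorem pure_diags {k : ℕ} {n : Fin k → ℕ} (B : ∀ i, PureSt (n i)) :
    ∃ x : ∀ i, Fin (n i), ∀ j, ∏ l ∈ Finset.univ.erase j, (B l).1 (x l) (x l) ≠ 0 := by
  choose x hx using fun i => pure_diag (B i).2
  exact ⟨x, fun j => Finset.prod_ne_zero_iff.mpr fun l _ => hx l⟩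

/-- permuted tensor product of linear maps as a multilinear map -/
noncomputable def tP {k : ℕ} (n : Fin k → ℕ) (π : Equiv.Perm (Fin k))
    (φ : ∀ j, Matrix (Fin (n (π j))) (Fin (n (π j))) ℂ →ₗ[ℂ] Matrix (Fin (n j)) (Fin (n j)) ℂ) :
    MultilinearMap ℂ (fun i => Matrix (Fin (n i)) (Fin (n i)) ℂ)
      (Matrix (∀ i, Fin (n i)) (∀ i, Fin (n i)) ℂ) :=
  have key : ∀ [DecidableEq (Fin k)] (A : ∀ i, Matrix (Fin (n i)) (Fin (n i)) ℂ) (j : Fin k)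
      (X : Matrix (Fin (n (π j))) (Fin (n (π j))) ℂ),
      (fun l => φ l (Function.update A (π j) X (π l))) =
        Function.update (fun l => φ l (A (π l))) j (φ j X) := by
    intro _ A j X
    funext l
    by_cases hl : l = j
    · subst hl; simp
    · rw [Function.update_of_ne hl, Function.update_of_ne (fun h => hl (π.injective h))]
  { toFun := fun A => tM n fun j => φ j (A (π j))
    map_update_add' := by
      intro _ A i X Y
      obtain ⟨j, rfl⟩ := π.surjective i
      rw [key, key, key, map_add, MultilinearMap.map_update_add]
    map_update_smul' := by
      intro _ A i c X
      obtain ⟨j, rfl⟩ := π.surjective i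
      rw [key, key, map_smul, MultilinearMap.map_update_smul] }

theorem struct_main {k : ℕ} {n : Fin k → ℕ} (h2 : ∀ i, 2 ≤ n i)
    (Ψ : Matrix (∀ i, Fin (n i)) (∀ i, Fin (n i)) ℂ →ₗ[ℂ]
        Matrix (∀ i, Fin (n i)) (∀ i, Fin (n i)) ℂ) (hΨ : Function.Injective Ψ)
    (hF : ∀ Q : ∀ i, PureSt (n i), ∃ Q', Ψ (toT Q) = toT Q')
    (hG : ∀ Q : ∀ i, PureSt (n i), ∃ Q', Ψ (toT Q') = toT Q) :
    ∃ (π : Equiv.Perm (Fin k)) (φ : ∀ j, Matrix (Fin (n (π j))) (Fin (n (π j))) ℂ →ₗ[ℂ]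
        Matrix (Fin (n j)) (Fin (n j)) ℂ),
      (∀ j A, IsPureState A → IsPureState (φ j A)) ∧ (∀ j, Function.Injective (φ j)) ∧
      ∀ A, Ψ (tensorPi A) = tensorPi fun j => φ j (A (π j)) := by
  choose F hF using hF
  choose G hG using hG
  have hGF : ∀ Q, G (F Q) = Q := fun Q => toT_inj (hΨ (by rw [hG, hF]))
  have hFG : ∀ Q, F (G Q) = Q := fun Q => toT_inj (by rw [← hF, hG])
  have hFi : Function.Injective F := Function.LeftInverse.injective hGF
  have hGi : Function.Injective G := Function.LeftInverse.injective hFG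
  let e := LinearEquiv.ofInjectiveEndo Ψ hΨ
  have hGe : ∀ Q, (e.symm : _ →ₗ[ℂ] _) (toT Q) = toT (G Q) := by
    intro Q
    rw [LinearEquiv.coe_coe, LinearEquiv.symm_apply_eq]
    exact (hG Q).symm
  have := fun i => pureSt_nontrivial (h2 i)
  obtain ⟨π, f, hf⟩ := hamming_aut F hFi (fun Q Q' h => adj_lemma Ψ F hFi hF h)
    (fun Q Q' h => by
      have := adj_lemma _ G hGi hGe h
      rwa [hGF, hGF] at this)
  obtain ⟨Q0⟩ : Nonempty (∀ i, PureSt (n i)) := inferInstance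
  obtain ⟨x, hx⟩ := pure_diags (F Q0)
  let φ : ∀ j, Matrix (Fin (n (π j))) (Fin (n (π j))) ℂ →ₗ[ℂ] Matrix (Fin (n j)) (Fin (n j)) ℂ :=
    fun j =>
      { toFun := fun A => (∏ l ∈ Finset.univ.erase j, (F Q0 l).1 (x l) (x l))⁻¹ •
          (Ψ (tM n (Function.update (fun i => (Q0 i).1) (π j) A))).submatrix
            (Function.update x j) (Function.update x j)
        map_add' := by
          intro A B
          rw [MultilinearMap.map_update_add, map_add]
          ext a b
          simp [mul_add]
        map_smul' := by
          intro c A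
          rw [MultilinearMap.map_update_smul, map_smul]
          ext a b
          simp
          ring }
  have hφ : ∀ j (A : PureSt (n (π j))), φ j A.1 = (f j A).1 := by
    intro j A
    have h1 : tM n (Function.update (fun i => (Q0 i).1) (π j) A.1) =
        toT (Function.update Q0 (π j) A) := by
      rw [tM_apply, toT]
      congr 1
      funext l
      by_cases hl : l = π j
      · subst hl; simp
      · rw [Function.update_of_ne hl, Function.update_of_ne hl]
    ext a b
    show (∏ l ∈ Finset.univ.erase j, (F Q0 l).1 (x l) (x l))⁻¹ *
          (Ψ (tM n (Function.update (fun i => (Q0 i).1) (π j) A.1)))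
            (Function.update x j a) (Function.update x j b) = _
    rw [h1, hF, toT, slice]
    have h3 : ∏ l ∈ Finset.univ.erase j, (F (Function.update Q0 (π j) A) l).1 (x l) (x l) =
        ∏ l ∈ Finset.univ.erase j, (F Q0 l).1 (x l) (x l) := by
      refine Finset.prod_congr rfl fun l hl => ?_
      rw [hf, hf, Function.update_of_ne]
      intro h
      exact Finset.ne_of_mem_erase hl (π.injective h)
    rw [h3, hf, Function.update_self]
    field_simp [hx j]
  have hmain : ∀ A, Ψ (tensorPi A) = tensorPi fun j => φ j (A (π j)) := by
    have : Ψ.compMultilinearMap (tM n) = tP n π φ := by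
      apply multi_ext_pure
      intro Q hQ
      have h1 := hF fun i => ⟨Q i, hQ i⟩
      simp only [LinearMap.compMultilinearMap_apply, tM_apply]
      refine Eq.trans h1 ?_
      show _ = tM n fun j => φ j (Q (π j))
      rw [tM_apply, toT]
      congr 1
      funext j
      rw [hf]
      exact (hφ j ⟨Q (π j), hQ (π j)⟩).symm
    intro A
    have h1 := congrArg (fun g => g A) this
    simp only [LinearMap.compMultilinearMap_apply, tM_apply] at h1
    rw [h1]
    show (tM n fun j => φ j (A (π j))) = _
    rw [tM_apply]
  refine ⟨π, φ, fun j A hA => ?_, fun j => ?_, hmain⟩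
  · rw [hφ j ⟨A, hA⟩]
    exact (f j ⟨A, hA⟩).2
  · rw [← LinearMap.ker_eq_bot, LinearMap.ker_eq_bot']
    intro A hA
    have h1 := hmain (Function.update (fun i => (Q0 i).1) (π j) A)
    have h3 : (tensorPi fun l => φ l (Function.update (fun i => (Q0 i).1) (π j) A (π l))) = 0 := by
      ext y z
      rw [tensorPi_apply]
      apply Finset.prod_eq_zero (Finset.mem_univ j)
      rw [Function.update_self, hA]; rfl
    rw [h3] at h1
    have h4 := hΨ (h1.trans (map_zero Ψ).symm)
    obtain ⟨x', hx'⟩ := pure_diags Q0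
    ext a b
    have h5 := congrFun (congrFun h4 (Function.update x' (π j) a)) (Function.update x' (π j) b)
    rw [slice, Function.update_self] at h5
    have h6 : ∏ l ∈ Finset.univ.erase (π j),
        Function.update (fun i => (Q0 i).1) (π j) A l (x' l) (x' l) =
        ∏ l ∈ Finset.univ.erase (π j), (Q0 l).1 (x' l) (x' l) := by
      refine Finset.prod_congr rfl fun l hl => ?_
      rw [Function.update_of_ne (Finset.ne_of_mem_erase hl)]
    rw [h6] at h5
    exact (mul_eq_zero.mp h5).resolve_right (hx' _)

end PNR

namespace PNR

theorem poly_z {b c d e f g h : ℂ}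
    (H : ∀ z : ℂ, b * z + c * star z + d * z ^ 2 + e * (z * star z) + f * star z ^ 2
      + g * (z ^ 2 * star z) + h * (z * star z ^ 2) = 0) : b = 0 ∧ d = 0 ∧ e = 0 ∧ g = 0 := by
  have hI := Complex.I_sq
  have a1 := H 1
  have a2 := H (-1)
  have a3 := H Complex.I
  have a4 := H (-Complex.I)
  have a5 := H 2
  have a6 := H (2 * Complex.I)
  have a7 := H (1 + Complex.I)
  have a8 := H (-1 - Complex.I)
  simp only [star_one, star_neg, star_sub, star_add, star_mul', star_ofNat, Complex.star_def,
    Complex.conj_I] at a1 a2 a3 a4 a5 a6 a7 a8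
  have e1 : d + e + f = 0 := by linear_combination (a1 + a2) / 2
  have e2 : -d + e - f = 0 := by
    linear_combination (a3 + a4) / 2 - (d - e + f) * hI
  have he : e = 0 := by linear_combination (e1 + e2) / 2
  have e3 : Complex.I * (d - f) = 0 := by
    linear_combination (a7 + a8) / 4 - (d + f - e) / 2 * hI - he
  have e4 : d = f := by
    rcases mul_eq_zero.mp e3 with h | h
    · exact absurd h Complex.I_ne_zero
    · exact sub_eq_zero.mp h
  have hd : d = 0 := by linear_combination (e1 - he + e4) / 2
  have hf : f = 0 := e4.symm.trans hd
  subst he hd hf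
  have e5 : g + h = 0 := by linear_combination (a5 - 2 * a1) / 6
  have e6 : b + c = 0 := by linear_combination a1 - e5
  have e7 : Complex.I * (g - h) = 0 := by
    linear_combination (a6 - 2 * a3) / 6 - (h - g) * Complex.I * hI
  have e8 : Complex.I * (b - c) = 0 := by
    linear_combination a3 - e7 - (h - g) * Complex.I * hI
  have e9 := sub_eq_zero.mp ((mul_eq_zero.mp e7).resolve_left Complex.I_ne_zero)
  have e10 := sub_eq_zero.mp ((mul_eq_zero.mp e8).resolve_left Complex.I_ne_zero)
  exact ⟨by linear_combination (e6 + e10) / 2, rfl, rfl, by linear_combination (e5 + e9) / 2⟩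

theorem pair_lemma {m : ℕ} {y v : Fin m → ℂ} {R : Matrix (Fin m) (Fin m) ℂ}
    (hy : (kb y).trace = 1) (hv : (kb v).trace = 1) (hyv : kb y ≠ kb v)
    (H : ∀ z : ℂ, ∃ s, kb y + z • R + star z • Rᴴ + (z * star z) • kb v = kb s) :
    ∃ c : ℂ, c * star c = 1 ∧ (R = c • vecMulVec v (star y) ∨ R = c • vecMulVec y (star v)) := by
  have hne : ∀ {u : Fin m → ℂ}, (kb u).trace = 1 → ∃ a, u a ≠ 0 := by
    intro u hu
    by_contra! hc
    simp [Matrix.trace, kb_apply, hc] at hu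
  obtain ⟨o, ho⟩ := hne hy
  obtain ⟨o', ho'⟩ := hne hv
  have hind : ∃ a b, y a * v b - y b * v a ≠ 0 := by
    by_contra! hc
    apply hyv
    apply kb_eq_of_par hy hv (t := v o / y o)
    funext a
    rw [Pi.smul_apply, smul_eq_mul, div_mul_eq_mul_div, eq_div_iff ho]
    linear_combination hc o a
  obtain ⟨i1, i2, h12⟩ := hind
  have h12' : star (y i1) * star (v i2) - star (y i2) * star (v i1) ≠ 0 := by
    have := star_ne_zero.mpr h12
    rwa [star_sub, star_mul', star_mul'] at this
  have hmin : ∀ a b c d, ∀ z : ℂ,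
      (y a * star (y b) + z * R a b + star z * star (R b a) + z * star z * (v a * star (v b))) *
      (y c * star (y d) + z * R c d + star z * star (R d c) + z * star z * (v c * star (v d))) =
      (y a * star (y d) + z * R a d + star z * star (R d a) + z * star z * (v a * star (v d))) *
      (y c * star (y b) + z * R c b + star z * star (R b c) + z * star z * (v c * star (v b))) := by
    intro a b c d z
    obtain ⟨s, hs⟩ := H z
    have e : ∀ a b, y a * star (y b) + z * R a b + star z * star (R b a) +
        z * star z * (v a * star (v b)) = s a * star (s b) := fun a b => congrFun (congrFun hs a) b
    rw [e, e, e, e]; ring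
  have hco := fun a b c d => poly_z
    (b := y a * star (y b) * R c d + R a b * (y c * star (y d)) -
      (y a * star (y d) * R c b + R a d * (y c * star (y b))))
    (c := y a * star (y b) * star (R d c) + star (R b a) * (y c * star (y d)) -
      (y a * star (y d) * star (R b c) + star (R d a) * (y c * star (y b))))
    (d := R a b * R c d - R a d * R c b)
    (e := y a * star (y b) * (v c * star (v d)) + v a * star (v b) * (y c * star (y d))
      + R a b * star (R d c) + star (R b a) * R c d -
      (y a * star (y d) * (v c * star (v b)) + v a * star (v d) * (y c * star (y b))
      + R a d * star (R b c) + star (R d a) * R c b))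
    (f := star (R b a) * star (R d c) - star (R d a) * star (R b c))
    (g := R a b * (v c * star (v d)) + v a * star (v b) * R c d -
      (R a d * (v c * star (v b)) + v a * star (v d) * R c b))
    (h := star (R b a) * (v c * star (v d)) + v a * star (v b) * star (R d c) -
      (star (R d a) * (v c * star (v b)) + v a * star (v d) * star (R b c)))
    (fun z => by linear_combination hmin a b c d z)
  clear hmin H
  have c1 := fun a b c d => (hco a b c d).1
  have c2 := fun a b c d => (hco a b c d).2.1
  have c4 := fun a b c d => (hco a b c d).2.2.1
  have c3 := fun a b c d => (hco a b c d).2.2.2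
  clear hco
  have hso : star (y o) ≠ 0 := star_ne_zero.mpr ho
  have hso' : star (v o') ≠ 0 := star_ne_zero.mpr ho'
  have hα : y o * star (y o) ≠ 0 := mul_ne_zero ho hso
  -- decomposition
  obtain ⟨q, hq⟩ : ∃ q : Fin m → ℂ, ∀ c, q c = R c o * y o - R o o * y c := ⟨_, fun _ => rfl⟩
  obtain ⟨p, hp⟩ : ∃ p : Fin m → ℂ, ∀ d, p d = R o d * star (y o) := ⟨_, fun _ => rfl⟩
  have hR : ∀ c d, y o * star (y o) * R c d = q c * star (y d) + y c * p d := by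
    intro c d
    rw [hq, hp]
    linear_combination c1 o o c d
  have hqp : ∀ a b c d, (q a * y c - y a * q c) * (star (y b) * p d - star (y d) * p b) = 0 := by
    intro a b c d
    have := c2 a b c d
    linear_combination (y o * star (y o)) ^ 2 * this
      - (y o * star (y o)) * R c d * hR a b - (q a * star (y b) + y a * p b) * hR c d
      + (y o * star (y o)) * R c b * hR a d + (q a * star (y d) + y a * p d) * hR c b
  have hcase : (∃ p' : Fin m → ℂ, ∀ c d, R c d = y c * p' d) ∨
      (∃ q' : Fin m → ℂ, ∀ c d, R c d = q' c * star (y d)) := by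
    by_cases hc : ∀ a c, q a * y c - y a * q c = 0
    · left
      refine ⟨fun d => (p d + q o / y o * star (y d)) / (y o * star (y o)), fun c d => ?_⟩
      have h1 : q c = q o / y o * y c := by
        rw [div_mul_eq_mul_div, eq_div_iff ho]
        linear_combination hc c o
      rw [mul_div_assoc', eq_div_iff hα, mul_comm, hR, h1]
      ring
    · right
      push Not at hc
      obtain ⟨a, c, hac⟩ := hc
      have hc2 : ∀ b d, star (y b) * p d - star (y d) * p b = 0 := fun b d =>
        (mul_eq_zero.mp (hqp a b c d)).resolve_left hac
      refine ⟨fun c => (q c + p o / star (y o) * y c) / (y o * star (y o)), fun c d => ?_⟩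
      have h1 : p d = p o / star (y o) * star (y d) := by
        rw [div_mul_eq_mul_div, eq_div_iff hso]
        linear_combination hc2 o d
      rw [div_mul_eq_mul_div, eq_div_iff hα, mul_comm, hR, h1]
      ring
  clear hR hqp hq hp c1 c2
  rcases hcase with ⟨p', hp'⟩ | ⟨q', hq'⟩
  · have h3 : ∀ b d, p' b * star (v d) - p' d * star (v b) = 0 := by
      intro b d
      have := c3 i1 b i2 d
      simp only [hp'] at this
      have h4 : (y i1 * v i2 - y i2 * v i1) * (p' b * star (v d) - p' d * star (v b)) = 0 := by
        linear_combination this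
      exact (mul_eq_zero.mp h4).resolve_left h12
    obtain ⟨t, ht⟩ : ∃ t : ℂ, t = p' o' / star (v o') := ⟨_, rfl⟩
    have h5 : ∀ d, p' d = t * star (v d) := by
      intro d
      rw [ht, div_mul_eq_mul_div, eq_div_iff hso']
      linear_combination h3 d o'
    refine ⟨t, ?_, Or.inr ?_⟩
    · have := c4 i1 i1 i2 i2
      simp only [hp', h5, star_mul', star_star] at this
      have h6 : (1 - t * star t) * ((y i1 * v i2 - y i2 * v i1) *
          (star (y i1) * star (v i2) - star (y i2) * star (v i1))) = 0 := by
        linear_combination this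
      have := (mul_eq_zero.mp h6).resolve_right (mul_ne_zero h12 h12')
      linear_combination -this
    · ext a b
      rw [hp', h5]
      simp [vecMulVec_apply]
      ring
  · have h3 : ∀ b d, q' b * v d - q' d * v b = 0 := by
      intro b d
      have := c3 b i1 d i2
      simp only [hq'] at this
      have h4 : (star (y i1) * star (v i2) - star (y i2) * star (v i1)) *
          (q' b * v d - q' d * v b) = 0 := by
        linear_combination this
      exact (mul_eq_zero.mp h4).resolve_left h12'
    obtain ⟨t, ht⟩ : ∃ t : ℂ, t = q' o' / v o' := ⟨_, rfl⟩
    have h5 : ∀ d, q' d = t * v d := by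
      intro d
      rw [ht, div_mul_eq_mul_div, eq_div_iff ho']
      linear_combination h3 d o'
    refine ⟨t, ?_, Or.inl ?_⟩
    · have := c4 i1 i1 i2 i2
      simp only [hq', h5, star_mul', star_star] at this
      have h6 : (1 - t * star t) * ((y i1 * v i2 - y i2 * v i1) *
          (star (y i1) * star (v i2) - star (y i2) * star (v i1))) = 0 := by
        linear_combination this
      have := (mul_eq_zero.mp h6).resolve_right (mul_ne_zero h12 h12')
      linear_combination -this
    · ext a b
      rw [hq', h5]
      simp [vecMulVec_apply]
      ring

end PNR

namespace PNR

theorem kb_transpose {m : ℕ} (x : Fin m → ℂ) : (kb x)ᵀ = kb (star x) := by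
  ext a b
  simp [kb_apply, mul_comm]

theorem core_straight {m : ℕ} (φ : Matrix (Fin m) (Fin m) ℂ →ₗ[ℂ] Matrix (Fin m) (Fin m) ℂ)
    (o : Fin m) (hr : ∀ x, ∃ y, φ (kb x) = kb y) (ho : ∀ X j, φ X j o = X j o) (X) : φ X = X := by
  have h1 : ∀ x : Fin m → ℂ, x o = 1 → φ (kb x) = kb x := by
    intro x hx
    obtain ⟨y, hy⟩ := hr x
    have e : ∀ j, y j * star (y o) = x j := by
      intro j
      have := ho (kb x) j
      rw [hy, kb_apply, kb_apply, hx] at this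
      simpa using this
    have eo := e o
    rw [hx] at eo
    rw [hy]
    ext a b
    rw [kb_apply, kb_apply, ← e a, ← e b, star_mul', star_star]
    linear_combination -(y a * star (y b)) * eo
  have h2 : ∀ x : Fin m → ℂ, x o ≠ 0 → φ (kb x) = kb x := by
    intro x hx
    have : x = (x o) • ((x o)⁻¹ • x) := by rw [smul_smul, mul_inv_cancel₀ hx, one_smul]
    rw [this, kb_smul, map_smul, h1]
    simp [hx]
  have h3 : ∀ x : Fin m → ℂ, φ (kb x) = kb x := by
    intro x
    by_cases hx : x o = 0
    · obtain ⟨e, he⟩ : ∃ e : Fin m → ℂ, e = Pi.single o 1 := ⟨_, rfl⟩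
      have heo : e o = 1 := by simp [he]
      have h4 : (2 : ℂ) • kb x = kb (x + e) + kb (x - e) - (2 : ℂ) • kb e := by
        ext a b
        simp [kb_apply]
        ring
      have h5 : (2 : ℂ) • φ (kb x) = (2 : ℂ) • kb x := by
        rw [← map_smul, h4, map_sub, map_add, map_smul, h2, h2, h1 e heo]
        · simp [hx, heo]
        · simp [hx, heo]
      exact smul_right_injective _ (two_ne_zero) h5
    · exact h2 x hx
  have : φ = LinearMap.id := ext_kb h3
  rw [this]; rfl

theorem entry_sum {m : ℕ} (φ : Matrix (Fin m) (Fin m) ℂ →ₗ[ℂ] Matrix (Fin m) (Fin m) ℂ)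
    (X : Matrix (Fin m) (Fin m) ℂ) (j l : Fin m) :
    φ X j l = ∑ a, ∑ b, X a b * φ (single a b 1) j l := by
  have : X = ∑ a, ∑ b, X a b • single a b (1 : ℂ) := by
    conv_lhs => rw [matrix_eq_sum_single X]
    simp [smul_single]
  conv_lhs => rw [this]
  simp only [map_sum, map_smul, Matrix.sum_apply, Matrix.smul_apply, smul_eq_mul]

theorem wigner_core {m : ℕ} (φ : Matrix (Fin m) (Fin m) ℂ →ₗ[ℂ] Matrix (Fin m) (Fin m) ℂ)
    (o : Fin m) (hr : ∀ x, ∃ y, φ (kb x) = kb y) (hH : ∀ X, φ Xᴴ = (φ X)ᴴ)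
    (hd : ∀ a, φ (single a a 1) = single a a 1)
    (h0 : ∀ a b, a ≠ b → ∃ c : ℂ, φ (single a b 1) = c • single a b 1 ∨
      φ (single a b 1) = c • single b a 1)
    (ho : ∀ a, φ (single a o 1) = single a o 1 ∨ φ (single a o 1) = single o a 1) :
    (∀ X, φ X = X) ∨ (∀ X, φ X = Xᵀ) := by
  have hoff : ∀ j l, j ≠ l → ∀ X, φ X j l =
      X j l * φ (single j l 1) j l + X l j * φ (single l j 1) j l := by
    intro j l hjl X
    have h1 : ∀ a b, φ (single a b 1) j l =
        (if a = j then if b = l then φ (single j l 1) j l else 0 else 0) +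
        (if a = l then if b = j then φ (single l j 1) j l else 0 else 0) := by
      intro a b
      by_cases hab : a = b
      · subst hab
        rw [hd]
        have : ¬ (a = j ∧ a = l) := by rintro ⟨rfl, h⟩; exact hjl h
        by_cases h1 : a = j
        · subst h1; simp [hjl]
        · by_cases h2 : a = l
          · subst h2; simp [h1]
          · simp [h1, h2]
      · by_cases h1 : a = j ∧ b = l
        · obtain ⟨rfl, rfl⟩ := h1
          simp [hjl]
        · by_cases h2 : a = l ∧ b = j
          · obtain ⟨rfl, rfl⟩ := h2
            simp [hab]
          · have e1 : (if a = j then if b = l then φ (single j l 1) j l else 0 else 0) = 0 := by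
              split_ifs with h3 h4
              · exact absurd ⟨h3, h4⟩ h1
              · rfl
              · rfl
            have e2 : (if a = l then if b = j then φ (single l j 1) j l else 0 else 0) = 0 := by
              split_ifs with h3 h4
              · exact absurd ⟨h3, h4⟩ h2
              · rfl
              · rfl
            rw [e1, e2]
            obtain ⟨c, hc | hc⟩ := h0 a b hab
            · rw [hc, Matrix.smul_apply, single_apply, if_neg (by tauto)]; simp
            · rw [hc, Matrix.smul_apply, single_apply, if_neg (by tauto)]; simp
    generalize φ (single j l 1) j l = α at h1 ⊢
    generalize φ (single l j 1) j l = β at h1 ⊢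
    rw [entry_sum]
    simp only [h1, mul_add, Finset.sum_add_distrib, mul_ite, mul_zero]
    simp
  have hdiag : ∀ j X, φ X j j = X j j := by
    intro j X
    have h1 : ∀ a b, φ (single a b 1) j j = if a = j then if b = j then (1 : ℂ) else 0 else 0 := by
      intro a b
      by_cases hab : a = b
      · subst hab
        rw [hd, single_apply]
        by_cases h : a = j <;> simp [h]
      · have e : (if a = j then if b = j then (1 : ℂ) else 0 else 0) = 0 := by
          split_ifs with h3 h4
          · exact absurd (h3.trans h4.symm) hab
          · rfl
          · rfl
        have h3 : ¬ (a = j ∧ b = j) := fun h => hab (h.1.trans h.2.symm)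
        rw [e]
        obtain ⟨c, hc | hc⟩ := h0 a b hab
        · rw [hc, Matrix.smul_apply, single_apply, if_neg (by tauto)]; simp
        · rw [hc, Matrix.smul_apply, single_apply, if_neg (by tauto)]; simp
    rw [entry_sum]
    simp [h1]
  have hconj : ∀ a b, φ (single a b 1) = (φ (single b a 1))ᴴ := by
    intro a b
    rw [← hH]; simp
  have hS : ∀ a, φ (single a o 1) = single a o 1 → ∀ X, φ X a o = X a o := by
    intro a ha X
    by_cases hao : a = o
    · subst hao; exact hdiag _ X
    · rw [hoff a o hao, hconj o a, ha]
      simp [hao]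
  have hT : ∀ a, φ (single a o 1) = single o a 1 → ∀ X, φ X a o = X o a := by
    intro a ha X
    by_cases hao : a = o
    · subst hao; exact hdiag _ X
    · rw [hoff a o hao, hconj o a, ha]
      simp [hao, Ne.symm hao]
  by_cases c1 : ∀ a, φ (single a o 1) = single a o 1
  · left
    exact core_straight φ o hr fun X j => hS j (c1 j) X
  by_cases c2 : ∀ a, φ (single a o 1) = single o a 1
  · right
    have h := core_straight (φ ∘ₗ (transposeLinearEquiv (Fin m) (Fin m) ℂ ℂ).toLinearMap) o
      (fun x => by
        obtain ⟨y, hy⟩ := hr (star x)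
        refine ⟨y, ?_⟩
        rw [← hy, ← kb_transpose]
        rfl)
      (fun X j => by
        have := hT j (c2 j) Xᵀ
        exact this)
    intro X
    have h3 := h Xᵀ
    exact h3
  exfalso
  push Not at c1 c2
  obtain ⟨l, hl⟩ := c1
  obtain ⟨j, hj⟩ := c2
  have hl' := (ho l).resolve_left hl
  have hj' := (ho j).resolve_right hj
  have hlo : l ≠ o := by rintro rfl; exact hl (hd _)
  have hjo : j ≠ o := by rintro rfl; exact hj (hd _)
  have hjl : j ≠ l := by rintro rfl; exact hl hj'
  have key : ∀ x : Fin m → ℂ, x o = 1 → x j * star (x l) * φ (single j l 1) j l +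
      x l * star (x j) * φ (single l j 1) j l = x j * x l := by
    intro x hx
    obtain ⟨y, hy⟩ := hr x
    have a1 := hS j hj' (kb x)
    have a2 := hT l hl' (kb x)
    have a3 := hoff j l hjl (kb x)
    have a4 := hdiag o (kb x)
    simp only [hy, kb_apply, hx, star_one, mul_one, one_mul] at a1 a2 a3 a4
    have a2' : star (y l) * y o = x l := by
      have := congrArg star a2
      simpa using this
    rw [← a3, ← a1, ← a2']
    linear_combination -(y j * star (y l)) * a4
  have k1 := key (fun _ => 1) rfl
  have k2 := key (fun a => if a = o then 1 else Complex.I) (by simp)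
  simp [hlo, hjo] at k1 k2
  rw [k1] at k2
  norm_num at k2

theorem kb_add_smul {m : ℕ} (u w : Fin m → ℂ) (z : ℂ) : kb (u + z • w) = kb u +
    z • vecMulVec w (star u) + star z • vecMulVec u (star w) + (z * star z) • kb w := by
  ext a b
  simp [kb_apply, vecMulVec_apply]
  ring

theorem single_vmv {m : ℕ} (a b : Fin m) : (single a b 1 : Matrix (Fin m) (Fin m) ℂ) =
    vecMulVec (Pi.single a 1) (star (Pi.single b 1)) := by
  ext i j
  simp [single_apply, vecMulVec_apply, Pi.single_apply]
  grind

theorem pairs {m : ℕ} (φ : Matrix (Fin m) (Fin m) ℂ →ₗ[ℂ] Matrix (Fin m) (Fin m) ℂ)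
    (hinj : Function.Injective φ) (hr : ∀ x, ∃ y, φ (kb x) = kb y) (hH : ∀ X, φ Xᴴ = (φ X)ᴴ)
    (htr : ∀ X, (φ X).trace = X.trace)
    (f : Fin m → Fin m → ℂ) (hf : ∀ j, φ (single j j 1) = kb (f j)) (j l : Fin m) (hjl : j ≠ l) :
    ∃ c : ℂ, c * star c = 1 ∧ (φ (single j l 1) = c • vecMulVec (f j) (star (f l)) ∨
      φ (single j l 1) = c • vecMulVec (f l) (star (f j))) := by
  have ht : ∀ j, (kb (f j)).trace = 1 := by
    intro j
    rw [← hf, htr]; simp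
  apply pair_lemma (ht l) (ht j)
  · rw [← hf, ← hf]
    intro h
    have := congrFun (congrFun (hinj h) j) j
    simp [hjl.symm] at this
  · intro z
    obtain ⟨s, hs⟩ := hr (Pi.single l 1 + z • Pi.single j 1)
    refine ⟨s, ?_⟩
    rw [← hs, kb_add_smul, ← single_vmv, ← single_vmv, show kb (Pi.single l 1) = single l l 1 from (single_vmv l l).symm,
      show kb (Pi.single j 1) = single j j 1 from (single_vmv j j).symm,
      map_add, map_add, map_add, map_smul, map_smul, map_smul, ← hf, ← hf, ← hH]
    simp

theorem wigner {m : ℕ} (hm : 0 < m) (φ : Matrix (Fin m) (Fin m) ℂ →ₗ[ℂ] Matrix (Fin m) (Fin m) ℂ)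
    (hinj : Function.Injective φ) (hp : ∀ P, IsPureState P → IsPureState (φ P)) :
    ∃ U : Matrix (Fin m) (Fin m) ℂ, U ∈ Matrix.unitaryGroup (Fin m) ℂ ∧
      ((∀ X, φ X = U * X * Uᴴ) ∨ (∀ X, φ X = U * Xᵀ * Uᴴ)) := by
  have hr : ∀ x, ∃ y, φ (kb x) = kb y := by
    intro x
    by_cases hx : x = 0
    · refine ⟨0, ?_⟩
      have : kb (0 : Fin m → ℂ) = 0 := by ext a b; simp [kb_apply]
      rw [hx, this, map_zero]
    · obtain ⟨r, P, hr, hP, h1, -⟩ := kb_scale hx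
      obtain ⟨y, hy, -⟩ := pure_exists (hp P hP)
      refine ⟨((Real.sqrt r : ℝ) : ℂ) • y, ?_⟩
      rw [h1, map_smul, hy, kb_smul]
      congr 1
      rw [Complex.star_def, Complex.conj_ofReal, ← Complex.ofReal_mul, Real.mul_self_sqrt hr.le]
  have htr : ∀ X, (φ X).trace = X.trace := by
    have : (traceLinearMap (Fin m) ℂ ℂ) ∘ₗ φ = traceLinearMap (Fin m) ℂ ℂ :=
      ext_pure fun P hP => by
        change (φ P).trace = P.trace
        rw [(hp P hP).2.2, hP.2.2]
    exact fun X => LinearMap.congr_fun this X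
  have hH : ∀ X, φ Xᴴ = (φ X)ᴴ := by
    let g : Matrix (Fin m) (Fin m) ℂ →ₗ[ℂ] Matrix (Fin m) (Fin m) ℂ :=
      { toFun := fun X => (φ Xᴴ)ᴴ
        map_add' := fun X Y => by simp
        map_smul' := fun c X => by simp }
    have : g = φ := ext_pure fun P hP => by
      change (φ Pᴴ)ᴴ = φ P
      rw [hP.1.eq, (hp P hP).1.eq]
    intro X
    have h := LinearMap.congr_fun this X
    change (φ Xᴴ)ᴴ = φ X at h
    rw [← h, conjTranspose_conjTranspose]
  have hf : ∀ j, ∃ f, φ (single j j 1) = kb f := by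
    intro j
    rw [single_vmv]
    exact hr _
  choose f hf using hf
  have hpf := pairs φ hinj hr hH htr f hf
  let o : Fin m := ⟨0, hm⟩
  have hg : ∀ j, ∃ g, φ (single j j 1) = kb g ∧ (j = o → g = f o) ∧
      (φ (single j o 1) = vecMulVec g (star (f o)) ∨
        φ (single j o 1) = vecMulVec (f o) (star g)) := by
    intro j
    by_cases hj : j = o
    · subst hj
      exact ⟨f o, hf o, fun _ => rfl, Or.inl (hf o)⟩
    · obtain ⟨c, hc, h | h⟩ := hpf j o hj
      · refine ⟨c • f j, ?_, fun h => absurd h hj, Or.inl ?_⟩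
        · rw [kb_smul, hc, one_smul, hf]
        · rw [h]; ext a b; simp [vecMulVec_apply]; ring
      · refine ⟨star c • f j, ?_, fun h => absurd h hj, Or.inr ?_⟩
        · rw [kb_smul, star_star, mul_comm, hc, one_smul, hf]
        · rw [h]; ext a b; simp [vecMulVec_apply]; ring
  choose g hg hgo hgt using hg
  have hgo := hgo o rfl
  rw [← hgo] at hgt
  have hpg := pairs φ hinj hr hH htr g hg
  have horth : ∀ j l, ∑ a, star (g j a) * g l a = if j = l then 1 else 0 := by
    intro j l
    split_ifs with hjl
    · subst hjl
      have : (kb (g j)).trace = 1 := by rw [← hg, htr]; simp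
      rw [← this]
      simp [Matrix.trace, kb_apply, mul_comm]
    · obtain ⟨c, hc, h⟩ := hpg j l hjl
      have hc0 : c ≠ 0 := by rintro rfl; simp at hc
      have h0 : (φ (single j l 1)).trace = 0 := by rw [htr]; simp [Matrix.trace, hjl]
      rcases h with h | h
      · rw [h, trace_smul, smul_eq_mul, mul_eq_zero, or_iff_right hc0] at h0
        have h1 := congrArg star h0
        rw [star_zero] at h1
        rw [← h1]
        simp [Matrix.trace, vecMulVec_apply]
      · rw [h, trace_smul, smul_eq_mul, mul_eq_zero, or_iff_right hc0] at h0
        rw [← h0]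
        simp [Matrix.trace, vecMulVec_apply, mul_comm]
  obtain ⟨U, hU⟩ : ∃ U : Matrix (Fin m) (Fin m) ℂ, ∀ a j, U a j = g j a :=
    ⟨Matrix.of fun a j => g j a, fun _ _ => rfl⟩
  have hU1 : Uᴴ * U = 1 := by
    ext j l
    rw [mul_apply, one_apply, ← horth]
    simp [hU]
  have hU2 : U * Uᴴ = 1 := mul_eq_one_comm.mp hU1
  have hUm : U ∈ Matrix.unitaryGroup (Fin m) ℂ := by
    rw [mem_unitaryGroup_iff]; exact hU2
  have hv : ∀ a b, Uᴴ * vecMulVec (g a) (star (g b)) * U = single a b 1 := by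
    intro a b
    have : vecMulVec (g a) (star (g b)) = U * single a b 1 * Uᴴ := by
      ext p q
      rw [single_vmv, mul_vecMulVec, vecMulVec_mul]
      simp [vecMulVec_apply, hU]
    rw [this]
    calc Uᴴ * (U * single a b 1 * Uᴴ) * U = (Uᴴ * U) * single a b 1 * (Uᴴ * U) := by
          simp only [Matrix.mul_assoc]
      _ = _ := by rw [hU1]; simp
  let φ1 : Matrix (Fin m) (Fin m) ℂ →ₗ[ℂ] Matrix (Fin m) (Fin m) ℂ :=
    (LinearMap.mulRight ℂ U) ∘ₗ (LinearMap.mulLeft ℂ Uᴴ) ∘ₗ φ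
  have hφ1 : ∀ X, φ1 X = Uᴴ * φ X * U := fun X => rfl
  have hback : ∀ X, φ X = U * φ1 X * Uᴴ := by
    intro X
    rw [hφ1]
    calc φ X = (U * Uᴴ) * φ X * (U * Uᴴ) := by rw [hU2]; simp
      _ = _ := by simp only [Matrix.mul_assoc]
  refine ⟨U, hUm, ?_⟩
  have := wigner_core φ1 o ?_ ?_ ?_ ?_ ?_
  · rcases this with h | h
    · exact Or.inl fun X => by rw [hback, h]
    · exact Or.inr fun X => by rw [hback, h]
  · intro x
    obtain ⟨y, hy⟩ := hr x
    refine ⟨Uᴴ *ᵥ y, ?_⟩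
    rw [hφ1, hy, kb, kb, mul_vecMulVec, vecMulVec_mul, star_mulVec, conjTranspose_conjTranspose]
  · intro X
    rw [hφ1, hφ1, hH]
    simp [Matrix.mul_assoc]
  · intro a
    rw [hφ1, hg, kb, hv]
  · intro a b hab
    obtain ⟨c, -, h | h⟩ := hpg a b hab
    · exact ⟨c, Or.inl (by rw [hφ1, h, Matrix.mul_smul, Matrix.smul_mul, hv])⟩
    · exact ⟨c, Or.inr (by rw [hφ1, h, Matrix.mul_smul, Matrix.smul_mul, hv])⟩
  · intro a
    rcases hgt a with h | h
    · exact Or.inl (by rw [hφ1, h, hv])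
    · exact Or.inr (by rw [hφ1, h, hv])

end PNR

namespace PNR

theorem pure_unitary {m : ℕ} {U A : Matrix (Fin m) (Fin m) ℂ} (hU : Uᴴ * U = 1)
    (hA : IsPureState A) : IsPureState (U * A * Uᴴ) := by
  obtain ⟨x, rfl, hx⟩ := pure_exists hA
  have h : U * kb x * Uᴴ = kb (U *ᵥ x) := by
    rw [kb, kb, mul_vecMulVec, vecMulVec_mul, star_mulVec]
  have ht : (U * kb x * Uᴴ).trace = 1 := by
    rw [trace_mul_comm, ← Matrix.mul_assoc, hU, Matrix.one_mul, hx]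
  rw [h] at ht ⊢
  exact kb_pure ht

theorem pure_transpose {m : ℕ} {A : Matrix (Fin m) (Fin m) ℂ}
    (hA : IsPureState A) : IsPureState Aᵀ := by
  obtain ⟨x, rfl, hx⟩ := pure_exists hA
  rw [← trace_transpose] at hx
  rw [kb_transpose] at hx ⊢
  exact kb_pure hx

theorem pure_cast {m p : ℕ} (h : p = m) {A : Matrix (Fin m) (Fin m) ℂ}
    (hA : IsPureState A) : IsPureState (A.submatrix (Fin.cast h) (Fin.cast h)) := by
  subst h
  exact hA

theorem c_to_a {k : ℕ} {n : Fin k → ℕ}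
    {Ψ ΨStar : Matrix (∀ i, Fin (n i)) (∀ i, Fin (n i)) ℂ →ₗ[ℂ]
        Matrix (∀ i, Fin (n i)) (∀ i, Fin (n i)) ℂ}
    (hadj : ∀ X Y, (Ψ X * Yᴴ).trace = (X * (ΨStar Y)ᴴ).trace)
    (π : Equiv.Perm (Fin k)) (hπ : ∀ i, n (π i) = n i)
    (ψ : ∀ i, Matrix (Fin (n i)) (Fin (n i)) ℂ → Matrix (Fin (n i)) (Fin (n i)) ℂ)
    (hψ : ∀ i, ∃ U : Matrix (Fin (n i)) (Fin (n i)) ℂ,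
          U ∈ Matrix.unitaryGroup (Fin (n i)) ℂ ∧
            ((∀ X, ψ i X = U * X * Uᴴ) ∨ (∀ X, ψ i X = U * Xᵀ * Uᴴ)))
    (hΨ : ∀ A : ∀ i, Matrix (Fin (n i)) (Fin (n i)) ℂ,
          Ψ (tensorPi A) =
            tensorPi fun i =>
              ψ i ((A (π i)).submatrix (Fin.cast (hπ i).symm) (Fin.cast (hπ i).symm)))
    (T) : prodNumRangePi (ΨStar T) = prodNumRangePi T := by
  have h1 : ∀ i A, IsPureState A → IsPureState (ψ i A) := by
    intro i A hA
    obtain ⟨U, hU, h⟩ := hψ i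
    have hU' : Uᴴ * U = 1 := mem_unitaryGroup_iff'.mp hU
    rcases h with h | h
    · rw [h]; exact pure_unitary hU' hA
    · rw [h]; exact pure_unitary hU' (pure_transpose hA)
  have h2 : ∀ i A, IsPureState A → ∃ B, IsPureState B ∧ ψ i B = A := by
    intro i A hA
    obtain ⟨U, hU, h⟩ := hψ i
    have hU' : U * Uᴴ = 1 := mem_unitaryGroup_iff.mp hU
    have hp : IsPureState (Uᴴ * A * U) := by
      have := pure_unitary (U := Uᴴ) (by rwa [conjTranspose_conjTranspose]) hA
      rwa [conjTranspose_conjTranspose] at this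
    have e : U * (Uᴴ * A * U) * Uᴴ = A := by
      calc U * (Uᴴ * A * U) * Uᴴ = (U * Uᴴ) * A * (U * Uᴴ) := by simp only [Matrix.mul_assoc]
        _ = A := by rw [hU']; simp
    rcases h with h | h
    · exact ⟨_, hp, by rw [h, e]⟩
    · exact ⟨_, pure_transpose hp, by rw [h, transpose_transpose, e]⟩
  ext z
  constructor
  · rintro ⟨Q, hQ, rfl⟩
    have hp : ∀ i, IsPureState
        (ψ i ((Q (π i)).submatrix (Fin.cast (hπ i).symm) (Fin.cast (hπ i).symm))) :=
      fun i => h1 i _ (pure_cast _ (hQ _))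
    exact ⟨_, hp, by rw [adj_trace hadj hQ, hΨ, tensorPi_pure_conj hp]⟩
  · rintro ⟨Q, hQ, rfl⟩
    choose B hB hBQ using fun i => h2 i (Q i) (hQ i)
    have hc : ∀ j, n j = n (π.symm j) := fun j => by
      have := hπ (π.symm j)
      rwa [Equiv.apply_symm_apply] at this
    have hA : ∀ j, IsPureState ((B (π.symm j)).submatrix (Fin.cast (hc j)) (Fin.cast (hc j))) :=
      fun j => pure_cast _ (hB _)
    refine ⟨_, hA, ?_⟩
    rw [adj_trace hadj hA, hΨ]
    have e : ∀ i i' (_ : i' = i) (h : n (π i) = n i'),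
        ((B i').submatrix (Fin.cast h) (Fin.cast h)).submatrix (Fin.cast (hπ i).symm)
          (Fin.cast (hπ i).symm) = B i := by
      rintro i _ rfl h
      rfl
    have e2 : (fun i => ψ i (((B (π.symm (π i))).submatrix (Fin.cast (hc (π i)))
        (Fin.cast (hc (π i)))).submatrix (Fin.cast (hπ i).symm) (Fin.cast (hπ i).symm))) = Q := by
      funext i
      rw [e i _ (Equiv.symm_apply_apply _ _), hBQ]
    rw [e2, tensorPi_pure_conj hQ]

theorem single_form {m p : ℕ} (hm : 0 < m) (h : p = m)
    (φ : Matrix (Fin p) (Fin p) ℂ →ₗ[ℂ] Matrix (Fin m) (Fin m) ℂ)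
    (hinj : Function.Injective φ) (hp : ∀ P, IsPureState P → IsPureState (φ P)) :
    ∃ ψ : Matrix (Fin m) (Fin m) ℂ → Matrix (Fin m) (Fin m) ℂ,
      (∃ U : Matrix (Fin m) (Fin m) ℂ, U ∈ Matrix.unitaryGroup (Fin m) ℂ ∧
        ((∀ X, ψ X = U * X * Uᴴ) ∨ (∀ X, ψ X = U * Xᵀ * Uᴴ))) ∧
      ∀ A, φ A = ψ (A.submatrix (Fin.cast h.symm) (Fin.cast h.symm)) := by
  subst h
  exact ⟨φ, wigner hm φ hinj hp, fun A => rfl⟩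

theorem b_to_c {k : ℕ} {n : Fin k → ℕ} (h2 : ∀ i, 2 ≤ n i)
    {Ψ ΨStar : Matrix (∀ i, Fin (n i)) (∀ i, Fin (n i)) ℂ →ₗ[ℂ]
        Matrix (∀ i, Fin (n i)) (∀ i, Fin (n i)) ℂ}
    (hadj : ∀ X Y, (Ψ X * Yᴴ).trace = (X * (ΨStar Y)ᴴ).trace)
    (hb : ∀ T, convexHull ℝ (prodNumRangePi (ΨStar T)) = convexHull ℝ (prodNumRangePi T)) :
    ∃ (π : Equiv.Perm (Fin k)) (hπ : ∀ i, n (π i) = n i)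
        (ψ : ∀ i, Matrix (Fin (n i)) (Fin (n i)) ℂ → Matrix (Fin (n i)) (Fin (n i)) ℂ),
        (∀ i, ∃ U : Matrix (Fin (n i)) (Fin (n i)) ℂ,
          U ∈ Matrix.unitaryGroup (Fin (n i)) ℂ ∧
            ((∀ X, ψ i X = U * X * Uᴴ) ∨ (∀ X, ψ i X = U * Xᵀ * Uᴴ))) ∧
        ∀ A : ∀ i, Matrix (Fin (n i)) (Fin (n i)) ℂ,
          Ψ (tensorPi A) =
            tensorPi fun i =>
              ψ i ((A (π i)).submatrix (Fin.cast (hπ i).symm) (Fin.cast (hπ i).symm)) := by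
  have hsurj : Function.Surjective Ψ := by
    rw [← LinearMap.range_eq_top]
    apply span_prod
    intro Q hQ
    obtain ⟨Q0, -, h⟩ := step1 hadj hb hQ
    exact ⟨_, h⟩
  have hinj : Function.Injective Ψ := LinearMap.injective_iff_surjective.mpr hsurj
  have hinj' : Function.Injective ΨStar := by
    rw [injective_iff_map_eq_zero]
    intro Y hY
    obtain ⟨X, hX⟩ := hsurj Y
    have := hadj X Y
    rw [hY, hX, conjTranspose_zero, Matrix.mul_zero, trace_zero] at this
    obtain ⟨s, hs, -, h0⟩ := frob Y
    apply h0
    rw [this] at hs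
    have : s = 0 := by exact_mod_cast hs.symm
    exact this.le
  let F := LinearEquiv.ofBijective Ψ ⟨hinj, hsurj⟩
  let G := LinearEquiv.ofBijective ΨStar ⟨hinj', LinearMap.injective_iff_surjective.mp hinj'⟩
  have hF : ∀ X, Ψ (F.symm X) = X := fun X => F.apply_symm_apply X
  have hF' : ∀ X, F.symm (Ψ X) = X := fun X => F.symm_apply_apply X
  have hG : ∀ X, ΨStar (G.symm X) = X := fun X => G.apply_symm_apply X
  have hadj2 : ∀ X Y, (F.symm.toLinearMap X * Yᴴ).trace = (X * (G.symm.toLinearMap Y)ᴴ).trace := by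
    intro X Y
    have := hadj (F.symm X) (G.symm Y)
    rw [hF, hG] at this
    exact this.symm
  have hb2 : ∀ T, convexHull ℝ (prodNumRangePi (G.symm.toLinearMap T)) =
      convexHull ℝ (prodNumRangePi T) := by
    intro T
    have := hb (G.symm T)
    rw [hG] at this
    exact this.symm
  obtain ⟨π, φ, hφp, hφi, hφ⟩ := struct_main h2 Ψ hinj
    (fun Q => by
      obtain ⟨Q0, h0, h⟩ := step1 hadj2 hb2 (fun i => (Q i).2)
      refine ⟨fun i => ⟨Q0 i, h0 i⟩, ?_⟩
      have h3 := congrArg Ψ h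
      exact h3.symm.trans (hF _))
    (fun Q => by
      obtain ⟨Q0, h0, h⟩ := step1 hadj hb (fun i => (Q i).2)
      exact ⟨fun i => ⟨Q0 i, h0 i⟩, h⟩)
  have hle : ∀ j, n (π j) ≤ n j := by
    intro j
    have := LinearMap.finrank_le_finrank_of_injective (hφi j)
    simp only [Module.finrank_matrix, Module.finrank_self, Fintype.card_fin, mul_one] at this
    exact Nat.mul_self_le_mul_self_iff.mp this
  have hπ : ∀ j, n (π j) = n j := by
    have hs : ∑ j, n (π j) = ∑ j, n j := Equiv.sum_comp π n
    intro j
    exact (Finset.sum_eq_sum_iff_of_le fun i _ => hle i).mp hs j (Finset.mem_univ _)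
  choose ψ hψ1 hψ2 using fun j => single_form (by have := h2 j; omega) (hπ j) (φ j) (hφi j)
    (fun P hP => hφp j P hP)
  refine ⟨π, hπ, ψ, hψ1, fun A => ?_⟩
  rw [hφ]
  congr 1
  funext j
  exact hψ2 j _

end PNR

/-- Theorem 4.2: for `k > 1`, `n₁ ≥ ⋯ ≥ n_k ≥ 2` and a `ℂ`-linear map `Ψ` on `M_N` with
adjoint `Ψ*` (with respect to `⟨X, Y⟩ = tr (XY*)`), the following are equivalent:
(a) `W^⊗(Ψ*(T)) = W^⊗(T)` for all `T`; (b) `conv W^⊗(Ψ*(T)) = conv W^⊗(T)` for all `T`;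
(c) there are a permutation `π` of `{1,…,k}` with `n_{π(i)} = n_i` and maps `ψ_i`, each of
the form `X ↦ U_i X U_i*` or `X ↦ U_i Xᵀ U_i*` for a unitary `U_i ∈ M_{n_i}`, such that
`Ψ(⊗_{i=1}^k A_i) = ⊗_{i=1}^k ψ_i(A_{π(i)})` for all `A_i ∈ M_{n_i}`. -/
theorem prodNumRangePi_preserver_form (k : ℕ) (hk : 1 < k) (n : Fin k → ℕ)
    (hmono : ∀ i j : Fin k, i ≤ j → n j ≤ n i) (h2 : ∀ i, 2 ≤ n i)
    (Ψ ΨStar : Matrix (∀ i, Fin (n i)) (∀ i, Fin (n i)) ℂ →ₗ[ℂ]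
        Matrix (∀ i, Fin (n i)) (∀ i, Fin (n i)) ℂ)
    (hadj : ∀ X Y, (Ψ X * Yᴴ).trace = (X * (ΨStar Y)ᴴ).trace) :
    [(∀ T, prodNumRangePi (ΨStar T) = prodNumRangePi T),
     (∀ T, convexHull ℝ (prodNumRangePi (ΨStar T)) = convexHull ℝ (prodNumRangePi T)),
     (∃ (π : Equiv.Perm (Fin k)) (hπ : ∀ i, n (π i) = n i)
        (ψ : ∀ i, Matrix (Fin (n i)) (Fin (n i)) ℂ → Matrix (Fin (n i)) (Fin (n i)) ℂ),
        (∀ i, ∃ U : Matrix (Fin (n i)) (Fin (n i)) ℂ,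
          U ∈ Matrix.unitaryGroup (Fin (n i)) ℂ ∧
            ((∀ X, ψ i X = U * X * Uᴴ) ∨ (∀ X, ψ i X = U * Xᵀ * Uᴴ))) ∧
        ∀ A : ∀ i, Matrix (Fin (n i)) (Fin (n i)) ℂ,
          Ψ (tensorPi A) =
            tensorPi fun i =>
              ψ i ((A (π i)).submatrix (Fin.cast (hπ i).symm) (Fin.cast (hπ i).symm)))].TFAE := by
  tfae_have 1 → 2 := fun h T => by rw [h T]
  tfae_have 2 → 3 := fun h => PNR.b_to_c h2 hadj h
  tfae_have 3 → 1 := by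
    rintro ⟨π, hπ, ψ, hψ, hΨ⟩
    exact PNR.c_to_a hadj π hπ ψ hψ hΨ
  tfae_finish
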